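/- arXiv:0706.2707 — 2 statements merged into one kernel-verified Lean document; each statement's English description precedes it below -/
import Mathlib

section
/- If n is even and p = 2, then R(n,2) ⊆ F_2·B̄_{[n/2,n/2]} + (Y_2 ∩ T) + Y_3, where F_2·B̄_{[n/2,n/2]} is the span of the basis element indexed by the composition [n/2, n/2]. -/
open scoped Classical

set_option synthInstance.maxHeartbeats 1000000
set_option maxHeartbeats 1000000

noncomputable section

/-- The group algebra `F_p[S_n]`. -/
abbrev GroupAlg (n p : ℕ) : Type := MonoidAlgebra (ZMod p) (Equiv.Perm (Fin n))

/-- The descent set of a permutation `σ` of `{1,…,n}` (1-based positions):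
`k ∈ {1,…,n-1}` is a descent if `σ(k) > σ(k+1)`.  (With 0-based `Fin n` indices this
compares the images at indices `k-1` and `k`.) -/
def descSet {n : ℕ} (σ : Equiv.Perm (Fin n)) : Set ℕ :=
  {k | ∃ h : k < n, 0 < k ∧ σ ⟨k, h⟩ < σ ⟨k - 1, by omega⟩}

/-- The set of proper partial sums `{a_1, a_1+a_2, …, a_1+⋯+a_{s-1}}` of a composition. -/
def properPartialSums {n : ℕ} (q : Composition n) : Set ℕ :=
  {m | ∃ i : ℕ, 0 < i ∧ i < q.length ∧ m = q.sizeUpTo i}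

/-- `B̄_q`: the sum of all permutations whose descent set is contained in the set of
proper partial sums of `q`. -/
def Bel (n p : ℕ) (q : Composition n) : GroupAlg n p :=
  ∑ σ ∈ Finset.univ.filter
      (fun σ : Equiv.Perm (Fin n) => descSet σ ⊆ properPartialSums q),
    MonoidAlgebra.of (ZMod p) (Equiv.Perm (Fin n)) σ

/-- The p-modular descent algebra `Σ(n,p)`, as a subalgebra of the group algebra. -/
def descentAlgebra (n p : ℕ) : Subalgebra (ZMod p) (GroupAlg n p) :=
  Algebra.adjoin (ZMod p) (Set.range (Bel n p))

/-- `B̄_q` as an element of `Σ(n,p)`. -/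
def BelS (n p : ℕ) (q : Composition n) : descentAlgebra n p :=
  ⟨Bel n p q, Algebra.subset_adjoin ⟨q, rfl⟩⟩

/-- The Jacobson radical `R(n,p)` of `Σ(n,p)`. -/
def descentRadical (n p : ℕ) : Ideal (descentAlgebra n p) :=
  (⊥ : Ideal (descentAlgebra n p)).jacobson

/-- `R(n,p)` viewed as an `F_p`-subspace of the group algebra. -/
def descentRadicalSubmodule (n p : ℕ) : Submodule (ZMod p) (GroupAlg n p) :=
  Submodule.map (descentAlgebra n p).val.toLinearMap
    ((descentRadical n p).restrictScalars (ZMod p))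

/-- `Y_m`: the span of the `B̄_q` with `q` having at least `m` components. -/
def Ysub (n p m : ℕ) : Submodule (ZMod p) (GroupAlg n p) :=
  Submodule.span (ZMod p) {x | ∃ q : Composition n, m ≤ q.length ∧ x = Bel n p q}

/-- `T`: the span of all differences `B̄_q - B̄_r` with `q ≈ r`. -/
def Tsub (n p : ℕ) : Submodule (ZMod p) (GroupAlg n p) :=
  Submodule.span (ZMod p)
    {x | ∃ q r : Composition n, q.blocks.Perm r.blocks ∧ x = Bel n p q - Bel n p r}

/-- `g(n,p)`: the number of partitions of `n` with no part divisible by `p`. -/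
def gPart (n p : ℕ) : ℕ := Set.ncard {π : n.Partition | ∀ i ∈ π.parts, ¬ p ∣ i}

/-- `g(n,p)`: the number of conjugacy classes of `p`-regular elements of `S_n`. -/
def gReg (n p : ℕ) : ℕ :=
  Set.ncard {c : ConjClasses (Equiv.Perm (Fin n)) | ∀ σ ∈ c.carrier, (orderOf σ).Coprime p}

/-- The Young character `χ_q`: `χ_q(σ)` is the number of ordered set partitions
`(P_1,…,P_s)` of `{1,…,n}` with `|P_i| = a_i`, each of whose blocks is `σ`-invariant. -/
def youngChar {n : ℕ} (q : Composition n) (σ : Equiv.Perm (Fin n)) : ℕ :=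
  (Finset.univ.filter (fun P : Fin q.length → Finset (Fin n) =>
    (∀ i, (P i).card = q.blocksFun i) ∧
    (∀ i j, i ≠ j → Disjoint (P i) (P j)) ∧
    (∀ x, ∃ i, x ∈ P i) ∧
    (∀ i, ∀ x ∈ P i, σ x ∈ P i))).card

/-- `χ̃_q`: the Young character with values reduced mod `p`. -/
def youngCharMod (n p : ℕ) (q : Composition n) : Equiv.Perm (Fin n) → ZMod p :=
  fun σ => (youngChar q σ : ZMod p)

/-- `G(n,p)`: the span of the mod-`p` Young characters. -/
def Gnp (n p : ℕ) : Submodule (ZMod p) (Equiv.Perm (Fin n) → ZMod p) :=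
  Submodule.span (ZMod p) (Set.range (youngCharMod n p))

/-- `S(q,r)`: matrices with row sums `q` and column sums `r`. -/
def SMat {n : ℕ} (q r : Composition n) : Set (Matrix (Fin q.length) (Fin r.length) ℕ) :=
  {Z | (∀ i, ∑ j, Z i j = q.blocksFun i) ∧ (∀ j, ∑ i, Z i j = r.blocksFun j)}

/-- `w(Z)`: the list of nonzero entries of `Z` read row by row. -/
def wList {s t : ℕ} (Z : Matrix (Fin s) (Fin t) ℕ) : List ℕ :=
  ((List.finRange s).flatMap fun i => ((List.finRange t).map fun j => Z i j)).filter
    (fun x => x ≠ 0)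

/-- One merging step: replace two adjacent components by their sum. -/
def mergeStep (l l' : List ℕ) : Prop :=
  ∃ (u v : List ℕ) (a b : ℕ), l = u ++ a :: b :: v ∧ l' = u ++ (a + b) :: v

/-- `coarsens l l'` (`l ⪯ l'` on compositions): `l'` is obtained from `l` by repeatedly
replacing adjacent components by their sum. -/
def coarsens (l l' : List ℕ) : Prop := Relation.ReflTransGen mergeStep l l'

/-- The positions at which the consecutive entries of a word differ. -/
def jumpSet {n : ℕ} {α : Type*} (u : Fin n → α) : Set ℕ :=
  {k | ∃ h : k < n, 0 < k ∧ u ⟨k - 1, by omega⟩ ≠ u ⟨k, h⟩}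

theorem eq_of_forall_notMem_jumpSet {n : ℕ} {α : Type*} {u : Fin n → α} {i j : Fin n}
    (hij : i ≤ j) (h : ∀ k ∈ jumpSet u, ¬ (i.val < k ∧ k ≤ j.val)) : u i = u j := by
  obtain ⟨i, hi⟩ := i
  obtain ⟨j, hj⟩ := j
  simp only [Fin.mk_le_mk] at hij
  induction j, hij using Nat.le_induction with
  | base => rfl
  | succ j hij ih =>
    rw [ih (by omega) fun k hk hk' => h k hk ⟨hk'.1, by simp at hk' ⊢; omega⟩]
    by_contra hne
    exact h (j + 1) ⟨hj, by omega, hne⟩ ⟨by simp; omega, le_rfl⟩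

theorem Monotone.eq_iff_forall_notMem_jumpSet {n : ℕ} {α : Type*} [PartialOrder α]
    {u : Fin n → α} (hu : Monotone u) {i j : Fin n} (hij : i ≤ j) :
    u i = u j ↔ ∀ k ∈ jumpSet u, ¬ (i.val < k ∧ k ≤ j.val) := by
  refine ⟨?_, eq_of_forall_notMem_jumpSet hij⟩
  rintro heq k ⟨hk, hk0, hne⟩ ⟨hik, hkj⟩
  refine hne (le_antisymm (hu (by simp)) ?_)
  calc u ⟨k, hk⟩ ≤ u j := hu hkj
    _ = u i := heq.symm
    _ ≤ u ⟨k - 1, by omega⟩ := hu (by rw [Fin.le_def]; simp; omega)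

theorem Monotone.eq_iff_eq_of_jumpSet_eq {n : ℕ} {α β : Type*} [PartialOrder α] [PartialOrder β]
    {u : Fin n → α} {v : Fin n → β} (hu : Monotone u) (hv : Monotone v)
    (h : jumpSet u = jumpSet v) (i j : Fin n) : u i = u j ↔ v i = v j := by
  rcases le_total i j with hij | hij
  · rw [hu.eq_iff_forall_notMem_jumpSet hij, hv.eq_iff_forall_notMem_jumpSet hij, h]
  · rw [eq_comm, hu.eq_iff_forall_notMem_jumpSet hij, eq_comm,
      hv.eq_iff_forall_notMem_jumpSet hij, h]

theorem lt_of_forall_notMem_descSet {n : ℕ} {σ : Equiv.Perm (Fin n)} {i j : Fin n}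
    (hij : i < j) (h : ∀ k ∈ descSet σ, ¬ (i.val < k ∧ k ≤ j.val)) : σ i < σ j := by
  obtain ⟨i, hi⟩ := i
  obtain ⟨j, hj⟩ := j
  have key : ∀ k (hk : k + 1 < n), i ≤ k → k + 1 ≤ j → σ ⟨k, by omega⟩ < σ ⟨k + 1, hk⟩ := by
    intro k hk hik hkj
    refine lt_of_le_of_ne (not_lt.1 fun hlt => ?_) (by simp)
    exact h (k + 1) ⟨hk, by omega, hlt⟩ ⟨by simp; omega, hkj⟩
  simp only [Fin.mk_lt_mk, ← Nat.succ_le_iff] at hij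
  induction j, hij using Nat.le_induction with
  | base => exact key i hj le_rfl le_rfl
  | succ j hij ih =>
    refine (ih (by omega) (fun k hk hk' => h k hk ⟨hk'.1, by simp at hk' ⊢; omega⟩)
      fun k hk h1 h2 => key k hk h1 (by omega)).trans (key j hj (by omega) le_rfl)

theorem sort_comp_inv_eq_iff {n : ℕ} {α : Type*} [LinearOrder α] {u : Fin n → α}
    (hu : Monotone u) (σ : Equiv.Perm (Fin n)) :
    Tuple.sort (u ∘ ⇑σ⁻¹) = σ ↔ descSet σ ⊆ jumpSet u := by
  have hc : (u ∘ ⇑σ⁻¹) ∘ σ = u := by ext; simp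
  rw [eq_comm, Tuple.eq_sort_iff, hc]
  simp only [hu, true_and, Function.comp_apply, Equiv.Perm.inv_def, Equiv.symm_apply_apply]
  constructor
  · rintro h k ⟨hk, hk0, hlt⟩
    exact ⟨hk, hk0, fun heq => hlt.not_gt (h _ _ (by rw [Fin.lt_def]; simp; omega) heq)⟩
  · intro h i j hij heq
    exact lt_of_forall_notMem_descSet hij fun k hk =>
      (hu.eq_iff_forall_notMem_jumpSet hij.le).1 heq k (h hk)

/-- The set of all rearrangements of a word. -/
def rearrangements {n : ℕ} {α : Type*} (u : Fin n → α) : Finset (Fin n → α) :=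
  Finset.univ.image fun σ : Equiv.Perm (Fin n) => u ∘ σ

theorem mem_rearrangements {n : ℕ} {α : Type*} {u h : Fin n → α} :
    h ∈ rearrangements u ↔ ∃ σ : Equiv.Perm (Fin n), u ∘ σ = h := by
  simp [rearrangements]

theorem sum_rearrangements {n : ℕ} {α M : Type*} [LinearOrder α] [AddCommMonoid M]
    {u : Fin n → α} (hu : Monotone u) (G : (Fin n → α) → M) :
    ∑ h ∈ rearrangements u, G h =
      ∑ σ ∈ Finset.univ.filter (fun σ : Equiv.Perm (Fin n) => descSet σ ⊆ jumpSet u),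
        G (u ∘ ⇑σ⁻¹) := by
  symm
  refine Finset.sum_bij' (fun σ _ => u ∘ ⇑σ⁻¹) (fun h _ => Tuple.sort h) ?_ ?_ ?_ ?_ ?_
  · intro σ _
    exact mem_rearrangements.2 ⟨σ⁻¹, rfl⟩
  · intro h hh
    obtain ⟨τ, rfl⟩ := mem_rearrangements.1 hh
    rw [Finset.mem_filter, ← sort_comp_inv_eq_iff hu]
    refine ⟨Finset.mem_univ _, ?_⟩
    congr 1
    have := Tuple.comp_perm_comp_sort_eq_comp_sort (f := u) (σ := τ)
    rw [Tuple.sort_eq_refl_iff_monotone.2 hu, Equiv.coe_refl, Function.comp_id] at this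
    nth_rewrite 1 [← this]
    ext; simp
  · intro σ hσ
    exact (sort_comp_inv_eq_iff hu σ).2 (Finset.mem_filter.1 hσ).2
  · intro h hh
    obtain ⟨τ, rfl⟩ := mem_rearrangements.1 hh
    have := Tuple.comp_perm_comp_sort_eq_comp_sort (f := u) (σ := τ)
    rw [Tuple.sort_eq_refl_iff_monotone.2 hu, Equiv.coe_refl, Function.comp_id] at this
    nth_rewrite 1 [← this]
    ext; simp
  · intros; rfl

/-- The permutation sorting the word `h`, paired with the indicator of `h` being constant on the
fibres of the colouring `c`. -/
def sortPair (p : ℕ) {n : ℕ} {α β : Type*} [LinearOrder α] (c : Fin n → β) (h : Fin n → α) :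
    GroupAlg n p × ZMod p :=
  (MonoidAlgebra.of (ZMod p) (Equiv.Perm (Fin n)) (Tuple.sort h),
    if h.FactorsThrough c then 1 else 0)

theorem sum_sortPair_eq_of_jumpSet_eq (p : ℕ) {n : ℕ} {α α' β : Type*} [LinearOrder α]
    [LinearOrder α'] (c : Fin n → β) {u : Fin n → α} {v : Fin n → α'} (hu : Monotone u)
    (hv : Monotone v) (h : jumpSet u = jumpSet v) :
    ∑ f ∈ rearrangements u, sortPair p c f = ∑ f ∈ rearrangements v, sortPair p c f := by
  rw [sum_rearrangements hu, sum_rearrangements hv, h]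
  refine Finset.sum_congr rfl fun σ hσ => ?_
  rw [Finset.mem_filter] at hσ
  have h2 : (u ∘ ⇑σ⁻¹).FactorsThrough c ↔ (v ∘ ⇑σ⁻¹).FactorsThrough c := by
    simp only [Function.FactorsThrough, Function.comp_apply, hu.eq_iff_eq_of_jumpSet_eq hv h]
  simp only [sortPair, (sort_comp_inv_eq_iff hu σ).2 (h ▸ hσ.2),
    (sort_comp_inv_eq_iff hv σ).2 hσ.2, h2]

theorem fst_sum_sortPair (p : ℕ) {n : ℕ} {α β : Type*} [LinearOrder α] (c : Fin n → β)
    {u : Fin n → α} (hu : Monotone u) {q : Composition n} (h : jumpSet u = properPartialSums q) :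
    (∑ f ∈ rearrangements u, sortPair p c f).1 = Bel n p q := by
  rw [sum_rearrangements hu, Prod.fst_sum, Bel, h]
  refine Finset.sum_congr rfl fun σ hσ => ?_
  rw [Finset.mem_filter] at hσ
  simp only [sortPair, (sort_comp_inv_eq_iff hu σ).2 (h ▸ hσ.2)]

theorem Composition.monotone_index {n : ℕ} (q : Composition n) : Monotone q.index := by
  intro i j hij
  by_contra hlt
  have h1 := q.monotone_sizeUpTo (show (q.index j).succ.val ≤ q.index i by
    rw [Fin.val_succ, Nat.succ_le_iff]; exact not_le.1 hlt)
  have h2 := q.sizeUpTo_index_le i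
  have h3 := q.lt_sizeUpTo_index_succ j
  have h4 : i.val ≤ j := hij
  omega

theorem jumpSet_index {n : ℕ} (q : Composition n) : jumpSet q.index = properPartialSums q := by
  ext k
  constructor
  · rintro ⟨hk, hk0, hne⟩
    have hlt := lt_of_le_of_ne (q.monotone_index (show (⟨k - 1, by omega⟩ : Fin n) ≤ ⟨k, hk⟩ by
      simp)) hne
    refine ⟨q.index ⟨k, hk⟩, by rw [Fin.lt_def] at hlt; omega, (q.index _).2, ?_⟩
    have h1 := q.sizeUpTo_index_le ⟨k, hk⟩
    have h2 := q.lt_sizeUpTo_index_succ ⟨k - 1, by omega⟩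
    have h3 := q.monotone_sizeUpTo (show (q.index ⟨k - 1, by omega⟩).succ.val ≤ q.index ⟨k, hk⟩ by
      rw [Fin.val_succ, Nat.succ_le_iff]; exact hlt)
    simp only at h1 h2
    omega
  · rintro ⟨i, hi0, hi, rfl⟩
    obtain ⟨i, rfl⟩ : ∃ m, i = m + 1 := ⟨i - 1, by omega⟩
    have h1 := q.sizeUpTo_strict_mono hi
    have h2 := q.sizeUpTo_le (i + 1 + 1)
    have h3 := q.sizeUpTo_strict_mono (show i < q.length by omega)
    refine ⟨by omega, by omega, ?_⟩
    have e1 : (⟨i + 1, hi⟩ : Fin q.length) = q.index ⟨q.sizeUpTo (i + 1), by omega⟩ :=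
      q.mem_range_embedding_iff'.1 (q.mem_range_embedding_iff.2 ⟨le_rfl, h1⟩)
    have e2 : (⟨i, by omega⟩ : Fin q.length) = q.index ⟨q.sizeUpTo (i + 1) - 1, by omega⟩ :=
      q.mem_range_embedding_iff'.1 (q.mem_range_embedding_iff.2
        ⟨by simp; omega, by simp; omega⟩)
    rw [← e1, ← e2]
    simp

theorem mem_boundaries_iff_properPartialSums {n : ℕ} (q : Composition n) (k : Fin (n + 1)) :
    k ∈ q.boundaries ↔ k.val = 0 ∨ k.val = n ∨ k.val ∈ properPartialSums q := by
  simp only [Composition.boundaries, Finset.mem_map, Finset.mem_univ, true_and]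
  constructor
  · rintro ⟨i, rfl⟩
    rcases Nat.eq_zero_or_pos i.val with h0 | h0
    · left
      show q.sizeUpTo i = 0
      simp [h0]
    · rcases Nat.lt_or_ge i.val q.length with h1 | h1
      · exact Or.inr (Or.inr ⟨i, h0, h1, rfl⟩)
      · exact Or.inr (Or.inl (q.sizeUpTo_ofLength_le i h1))
  · rintro (h | h | ⟨i, h0, h1, h2⟩)
    · exact ⟨0, Fin.ext (by simp [h])⟩
    · exact ⟨Fin.last _, Fin.ext (by simp [h])⟩
    · exact ⟨⟨i, by omega⟩, Fin.ext h2.symm⟩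

theorem properPartialSums_injective (n : ℕ) :
    Function.Injective (properPartialSums : Composition n → Set ℕ) := by
  intro q r h
  refine (compositionEquiv n).injective (CompositionAsSet.ext ?_)
  ext k
  show k ∈ q.boundaries ↔ k ∈ r.boundaries
  rw [mem_boundaries_iff_properPartialSums, mem_boundaries_iff_properPartialSums, h]

theorem properPartialSums_subset {n : ℕ} (q : Composition n) {k : ℕ}
    (hk : k ∈ properPartialSums q) : 0 < k ∧ k < n := by
  rw [← jumpSet_index] at hk
  exact ⟨hk.2.1, hk.1⟩

theorem exists_properPartialSums_eq_jumpSet {n : ℕ} {α : Type*} (u : Fin n → α) :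
    ∃ q : Composition n, properPartialSums q = jumpSet u := by
  let s : CompositionAsSet n :=
    { boundaries := Finset.univ.filter fun k => k.val = 0 ∨ k.val = n ∨ k.val ∈ jumpSet u
      zero_mem := by simp
      getLast_mem := by simp }
  refine ⟨s.toComposition, Set.ext fun k => ?_⟩
  by_cases hk : 0 < k ∧ k < n
  · have := mem_boundaries_iff_properPartialSums s.toComposition ⟨k, by omega⟩
    rw [s.toComposition_boundaries] at this
    simp only [s, Finset.mem_filter, Finset.mem_univ, true_and] at this
    have h1 : k ≠ 0 := by omega
    have h2 : k ≠ n := by omega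
    tauto
  · exact iff_of_false (fun h => hk (properPartialSums_subset _ h)) fun h => hk ⟨h.2.1, h.1⟩

/-- The span of the elements `(B̄_q, N_q)`, where `N_q` is the number of rearrangements of the
index word of `q` that are constant on the fibres of the colouring `c`. -/
def sortSpan (p : ℕ) {n : ℕ} {β : Type*} (c : Fin n → β) :
    Submodule (ZMod p) (GroupAlg n p × ZMod p) :=
  Submodule.span (ZMod p)
    (Set.range fun q : Composition n => ∑ f ∈ rearrangements q.index, sortPair p c f)

theorem sum_rearrangements_mem_sortSpan (p : ℕ) {n : ℕ} {α β : Type*} [LinearOrder α]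
    (c : Fin n → β) {u : Fin n → α} (hu : Monotone u) :
    ∑ f ∈ rearrangements u, sortPair p c f ∈ sortSpan p c := by
  obtain ⟨q, hq⟩ := exists_properPartialSums_eq_jumpSet u
  rw [sum_sortPair_eq_of_jumpSet_eq p c hu q.monotone_index (by rw [jumpSet_index, hq])]
  exact Submodule.subset_span ⟨q, rfl⟩

theorem sum_sortPair_mem_sortSpan (p : ℕ) {n : ℕ} {α β : Type*} [LinearOrder α]
    (c : Fin n → β) (P : Finset (Fin n → α))
    (hP : ∀ h ∈ P, ∀ σ : Equiv.Perm (Fin n), h ∘ σ ∈ P) :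
    ∑ f ∈ P, sortPair p c f ∈ sortSpan p c := by
  rw [← Finset.sum_fiberwise_of_maps_to
    (fun h hh => Finset.mem_image_of_mem (fun h : Fin n → α => h ∘ Tuple.sort h) hh)]
  refine Submodule.sum_mem _ fun u hu => ?_
  obtain ⟨h, hh, rfl⟩ := Finset.mem_image.1 hu
  convert sum_rearrangements_mem_sortSpan p c (Tuple.monotone_sort h) using 2
  ext g
  rw [Finset.mem_filter, mem_rearrangements]
  constructor
  · rintro ⟨_, hg⟩
    refine ⟨(Tuple.sort g)⁻¹, ?_⟩
    rw [← hg]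
    ext; simp
  · rintro ⟨τ, rfl⟩
    rw [Function.comp_assoc, ← Equiv.Perm.coe_mul]
    exact ⟨hP h hh _, Tuple.comp_perm_comp_sort_eq_comp_sort⟩

theorem sort_mul_sort {n : ℕ} {α β : Type*} [LinearOrder α] [LinearOrder β]
    (f : Fin n → α) (g : Fin n → β) :
    Tuple.sort f * Tuple.sort g =
      Tuple.sort fun x => toLex ((g ∘ ⇑(Tuple.sort f)⁻¹) x, f x) := by
  obtain ⟨hf, hf'⟩ := Tuple.eq_sort_iff.1 (rfl : Tuple.sort f = _)
  obtain ⟨hg, hg'⟩ := Tuple.eq_sort_iff.1 (rfl : Tuple.sort g = _)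
  rw [Tuple.eq_sort_iff]
  simp only [Function.comp_apply, Equiv.Perm.mul_apply, Equiv.Perm.inv_def,
    Equiv.symm_apply_apply]
  constructor
  · intro i j hij
    simp only [Function.comp_apply, Equiv.Perm.mul_apply, Equiv.symm_apply_apply]
    rw [Prod.Lex.toLex_le_toLex]
    rcases (hg hij).lt_or_eq with h | h
    · exact Or.inl h
    · rcases hij.lt_or_eq with hlt | rfl
      · exact Or.inr ⟨h, hf (hg' i j hlt h).le⟩
      · exact Or.inr ⟨rfl, le_rfl⟩
  · intro i j hij heq
    rw [toLex_inj, Prod.mk.injEq] at heq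
    exact hf' _ _ (hg' i j hij heq.1) heq.2

theorem sum_sortPair_mul_sum_sortPair (p : ℕ) {n : ℕ} {α α' β : Type*} [LinearOrder α]
    [LinearOrder α'] (c : Fin n → β) (u : Fin n → α) (v : Fin n → α') :
    (∑ f ∈ rearrangements u, sortPair p c f) * (∑ g ∈ rearrangements v, sortPair p c g) =
      ∑ h ∈ (rearrangements u ×ˢ rearrangements v).image
        (fun fg x => toLex (fg.2 x, fg.1 x)), sortPair p c h := by
  rw [Finset.sum_image, Finset.sum_product, Finset.sum_mul_sum]
  · refine Prod.ext ?_ ?_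
    · simp only [Prod.fst_sum]
      refine Finset.sum_congr rfl fun f _ => ?_
      refine Finset.sum_bij' (fun g _ => g ∘ ⇑(Tuple.sort f)⁻¹) (fun g _ => g ∘ Tuple.sort f)
        ?_ ?_ ?_ ?_ ?_
      · rintro g hg
        obtain ⟨τ, rfl⟩ := mem_rearrangements.1 hg
        exact mem_rearrangements.2 ⟨τ * (Tuple.sort f)⁻¹, rfl⟩
      · rintro g hg
        obtain ⟨τ, rfl⟩ := mem_rearrangements.1 hg
        exact mem_rearrangements.2 ⟨τ * Tuple.sort f, rfl⟩
      · intro g _; ext; simp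
      · intro g _; ext; simp
      · intro g _
        simp only [sortPair, Prod.fst_mul, ← map_mul, sort_mul_sort]
    · simp only [Prod.snd_sum, sortPair, Prod.snd_mul]
      refine Finset.sum_congr rfl fun f _ => Finset.sum_congr rfl fun g _ => ?_
      have : (fun x => toLex (g x, f x)).FactorsThrough c ↔
          f.FactorsThrough c ∧ g.FactorsThrough c := by
        simp only [Function.FactorsThrough, toLex_inj, Prod.mk.injEq]
        exact ⟨fun h => ⟨fun _ _ e => (h e).2, fun _ _ e => (h e).1⟩,
          fun h _ _ e => ⟨h.2 e, h.1 e⟩⟩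
      simp only [this, ite_and, mul_ite, mul_one, mul_zero]
      split_ifs <;> rfl
  · rintro ⟨f, g⟩ _ ⟨f', g'⟩ _ h
    have h' := fun x => congrFun h x
    simp only [toLex_inj, Prod.mk.injEq] at h'
    exact Prod.ext (funext fun x => (h' x).2) (funext fun x => (h' x).1)

theorem mul_mem_sortSpan (p : ℕ) {n : ℕ} {β : Type*} (c : Fin n → β)
    {x y : GroupAlg n p × ZMod p} (hx : x ∈ sortSpan p c) (hy : y ∈ sortSpan p c) :
    x * y ∈ sortSpan p c := by
  have hle : sortSpan p c * sortSpan p c ≤ sortSpan p c := by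
    nth_rewrite 1 [sortSpan]
    nth_rewrite 1 [sortSpan]
    rw [Submodule.span_mul_span, Submodule.span_le]
    rintro _ ⟨_, ⟨q, rfl⟩, _, ⟨r, rfl⟩, rfl⟩
    simp only [SetLike.mem_coe]
    rw [sum_sortPair_mul_sum_sortPair]
    refine sum_sortPair_mem_sortSpan p c _ fun h hh σ => ?_
    obtain ⟨⟨f, g⟩, hfg, rfl⟩ := Finset.mem_image.1 hh
    rw [Finset.mem_product, mem_rearrangements, mem_rearrangements] at hfg
    obtain ⟨⟨τ, hf⟩, ⟨ρ, hg⟩⟩ := hfg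
    simp only at hf hg
    subst hf hg
    refine Finset.mem_image.2 ⟨⟨q.index ∘ ⇑(τ * σ), r.index ∘ ⇑(ρ * σ)⟩, ?_, rfl⟩
    exact Finset.mem_product.2 ⟨mem_rearrangements.2 ⟨_, rfl⟩, mem_rearrangements.2 ⟨_, rfl⟩⟩
  exact hle (Submodule.mul_mem_mul hx hy)

theorem one_mem_sortSpan (p : ℕ) {n : ℕ} {β : Type*} (c : Fin n → β) :
    (1 : GroupAlg n p × ZMod p) ∈ sortSpan p c := by
  have hmono : Monotone fun _ : Fin n => () := monotone_const
  convert sum_rearrangements_mem_sortSpan p c hmono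
  have : rearrangements (fun _ : Fin n => ()) = {fun _ => ()} := by
    ext h
    simp [mem_rearrangements, eq_iff_true_of_subsingleton]
  rw [this, Finset.sum_singleton, sortPair, Tuple.sort_eq_refl_iff_monotone.2 hmono,
    if_pos (show Function.FactorsThrough (fun _ : Fin n => ()) c from fun _ _ _ => rfl)]
  rfl

theorem exists_mem_sortSpan_of_mem_descentAlgebra (p : ℕ) {n : ℕ} {β : Type*} (c : Fin n → β)
    {x : GroupAlg n p} (hx : x ∈ descentAlgebra n p) : ∃ a, (x, a) ∈ sortSpan p c := by
  induction hx using Algebra.adjoin_induction with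
  | mem x hx =>
    obtain ⟨q, rfl⟩ := hx
    refine ⟨(∑ f ∈ rearrangements q.index, sortPair p c f).2, ?_⟩
    rw [← fst_sum_sortPair p c q.monotone_index (jumpSet_index q)]
    exact Submodule.subset_span ⟨q, rfl⟩
  | algebraMap r =>
    refine ⟨r, ?_⟩
    convert Submodule.smul_mem _ r (one_mem_sortSpan p c) using 1
    refine Prod.ext ?_ ?_
    · simp [Algebra.algebraMap_eq_smul_one]
    · simp
  | add x y _ _ hx hy =>
    obtain ⟨a, ha⟩ := hx
    obtain ⟨b, hb⟩ := hy
    refine ⟨a + b, ?_⟩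
    rw [← Prod.mk_add_mk]
    exact Submodule.add_mem _ ha hb
  | mul x y _ _ hx hy =>
    obtain ⟨a, ha⟩ := hx
    obtain ⟨b, hb⟩ := hy
    refine ⟨a * b, ?_⟩
    rw [← Prod.mk_mul_mk]
    exact mul_mem_sortSpan p c ha hb

theorem coeff_Bel (n p : ℕ) (q : Composition n) (σ : Equiv.Perm (Fin n)) :
    (Bel n p q).coeff σ = if descSet σ ⊆ properPartialSums q then 1 else 0 := by
  simp [Bel, MonoidAlgebra.coeff_sum, Finsupp.finsetSum_apply, MonoidAlgebra.of_apply,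
    Finsupp.single_apply]

theorem exists_descSet_eq {n : ℕ} (q : Composition n) :
    ∃ σ : Equiv.Perm (Fin n), descSet σ = properPartialSums q := by
  let f : Fin n → (Fin q.length)ᵒᵈ := fun i => OrderDual.toDual (q.index i)
  refine ⟨(Tuple.sort f)⁻¹, ?_⟩
  obtain ⟨hf, hf'⟩ := Tuple.eq_sort_iff.1 (rfl : Tuple.sort f = _)
  rw [← jumpSet_index]
  ext k
  refine exists_congr fun hk => and_congr_right fun hk0 => ?_
  set i : Fin n := ⟨k - 1, by omega⟩
  set j : Fin n := ⟨k, hk⟩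
  have hij : i ≤ j := by rw [Fin.le_def]; simp [i, j]
  have hne : i ≠ j := by rw [Ne, Fin.ext_iff]; simp [i, j]; omega
  have hfs : ∀ x, f (Tuple.sort f ((Tuple.sort f)⁻¹ x)) = f x := fun x => by simp
  constructor
  · intro hlt heq
    have := hf' _ _ hlt (by rw [hfs, hfs]; exact congrArg OrderDual.toDual heq.symm)
    simp only [Equiv.Perm.inv_def, Equiv.apply_symm_apply] at this
    exact this.not_ge hij
  · intro hne'
    by_contra hge
    have h1 : f i ≤ f j := by
      have := hf (not_lt.1 hge)
      rwa [Function.comp_apply, Function.comp_apply, hfs, hfs] at this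
    exact hne' (le_antisymm (q.monotone_index hij) h1)

theorem linearIndependent_Bel (n p : ℕ) : LinearIndependent (ZMod p) (Bel n p) := by
  rw [Fintype.linearIndependent_iff]
  intro a ha
  by_contra! hne
  obtain ⟨q₀, hq₀⟩ := hne
  obtain ⟨q, hq, hmax⟩ := Finset.exists_maximalFor (fun q : Composition n => properPartialSums q)
    (Finset.univ.filter fun q => a q ≠ 0) ⟨q₀, by simpa using hq₀⟩
  rw [Finset.mem_filter] at hq
  obtain ⟨σ, hσ⟩ := exists_descSet_eq q
  have hcoeff := congrArg (fun x => x.coeff σ) ha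
  simp only [MonoidAlgebra.coeff_sum, MonoidAlgebra.coeff_smul, MonoidAlgebra.coeff_zero,
    Finsupp.finsetSum_apply, Finsupp.smul_apply, Finsupp.zero_apply, coeff_Bel, hσ] at hcoeff
  rw [Finset.sum_eq_single q] at hcoeff
  · exact hq.2 (by simpa using hcoeff)
  · intro r _ hrq
    split_ifs with hsub
    · by_cases har : a r = 0
      · rw [har, zero_smul]
      · exact absurd (properPartialSums_injective n
          (le_antisymm (hmax (by simpa using har) hsub) hsub)) hrq
    · rw [smul_zero]
  · simp

/-- The number, modulo `p`, of rearrangements of the index word of `q` that are constant on the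
fibres of the colouring `c`. -/
def numFactoring (p : ℕ) {n : ℕ} {β : Type*} (c : Fin n → β) (q : Composition n) : ZMod p :=
  (((rearrangements q.index).filter fun h => h.FactorsThrough c).card : ZMod p)

theorem sum_sortPair_index (p : ℕ) {n : ℕ} {β : Type*} (c : Fin n → β) (q : Composition n) :
    ∑ f ∈ rearrangements q.index, sortPair p c f = (Bel n p q, numFactoring p c q) := by
  refine Prod.ext (fst_sum_sortPair p c q.monotone_index (jumpSet_index q)) ?_
  simp only [Prod.snd_sum, sortPair, numFactoring, Finset.sum_boole]

theorem mem_sortSpan_iff (p : ℕ) {n : ℕ} {β : Type*} (c : Fin n → β) (x : GroupAlg n p)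
    (t : ZMod p) : (x, t) ∈ sortSpan p c ↔ ∃ a : Composition n → ZMod p,
      ∑ q, a q • Bel n p q = x ∧ ∑ q, a q * numFactoring p c q = t := by
  simp only [sortSpan, sum_sortPair_index, Submodule.mem_span_range_iff_exists_fun]
  simp only [Prod.ext_iff, Prod.fst_sum, Prod.snd_sum, Prod.smul_fst, Prod.smul_snd, smul_eq_mul]

theorem eq_zero_of_zero_mem_sortSpan (p : ℕ) {n : ℕ} {β : Type*} (c : Fin n → β)
    {t : ZMod p} (h : ((0 : GroupAlg n p), t) ∈ sortSpan p c) : t = 0 := by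
  obtain ⟨a, ha, rfl⟩ := (mem_sortSpan_iff p c _ _).1 h
  have := Fintype.linearIndependent_iff.1 (linearIndependent_Bel n p) a ha
  simp [this]

theorem eq_zero_of_mem_sortSpan_of_mem_descentRadicalSubmodule (p : ℕ) [Fact p.Prime] {n : ℕ}
    {β : Type*} (c : Fin n → β) {x : GroupAlg n p} {t : ZMod p} (h : (x, t) ∈ sortSpan p c)
    (hx : x ∈ descentRadicalSubmodule n p) : t = 0 := by
  by_contra ht
  obtain ⟨x, hxr, rfl⟩ := hx
  obtain ⟨z, hz⟩ := Ideal.mem_jacobson_iff.1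
    ((Submodule.restrictScalars_mem _ _ _).1 hxr) (algebraMap (ZMod p) _ (-t⁻¹))
  rw [Ideal.mem_bot] at hz
  obtain ⟨l, hl⟩ := exists_mem_sortSpan_of_mem_descentAlgebra p c z.2
  have hmem := Submodule.sub_mem _ (Submodule.add_mem _
    (mul_mem_sortSpan p c hl (Submodule.smul_mem _ (-t⁻¹) h)) hl) (one_mem_sortSpan p c)
  have hz' : (z : GroupAlg n p) * (-t⁻¹ • (x : GroupAlg n p)) + z - 1 = 0 := by
    have := congrArg (Subtype.val : descentAlgebra n p → GroupAlg n p) hz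
    simpa [mul_assoc, Algebra.algebraMap_eq_smul_one] using this
  have he : ((z : GroupAlg n p), l) * (-t⁻¹ • ((x : GroupAlg n p), t)) + ((z : GroupAlg n p), l) - 1
      = (0, -1) := by
    refine Prod.ext hz' ?_
    simp [ht]
  have := eq_zero_of_zero_mem_sortSpan p c (he ▸ hmem)
  simp at this

theorem exists_coeffs_of_mem_descentRadicalSubmodule (p : ℕ) [Fact p.Prime] {n : ℕ}
    {x : GroupAlg n p} (hx : x ∈ descentRadicalSubmodule n p) :
    ∃ a : Composition n → ZMod p, ∑ q, a q • Bel n p q = x ∧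
      ∀ {β : Type} (c : Fin n → β), ∑ q, a q * numFactoring p c q = 0 := by
  have hxs : x ∈ descentAlgebra n p := by
    obtain ⟨x, _, rfl⟩ := hx
    exact x.2
  obtain ⟨t, ht⟩ := exists_mem_sortSpan_of_mem_descentAlgebra p (fun _ : Fin n => ()) hxs
  obtain ⟨a, ha, _⟩ := (mem_sortSpan_iff p _ _ _).1 ht
  exact ⟨a, ha, fun c => eq_zero_of_mem_sortSpan_of_mem_descentRadicalSubmodule p c
    ((mem_sortSpan_iff p c _ _).2 ⟨a, ha, rfl⟩) hx⟩

theorem mem_rearrangements_iff_card {n : ℕ} {α : Type*} [DecidableEq α] {u h : Fin n → α} :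
    h ∈ rearrangements u ↔
      ∀ i, Fintype.card {x // h x = i} = Fintype.card {x // u x = i} := by
  rw [mem_rearrangements]
  constructor
  · rintro ⟨σ, rfl⟩ i
    exact Fintype.card_congr (σ.subtypeEquiv fun _ => Iff.rfl)
  · intro hc
    let e := Equiv.ofFiberEquiv fun i => Fintype.equivOfCardEq (hc i)
    exact ⟨e, funext fun x => Equiv.ofFiberEquiv_map _ x⟩

theorem Composition.card_index_eq {n : ℕ} (q : Composition n) (i : Fin q.length) :
    Fintype.card {x // q.index x = i} = q.blocksFun i := by
  rw [← Fintype.card_fin (q.blocksFun i)]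
  refine (Fintype.card_congr (Equiv.ofBijective
    (fun j => (⟨q.embedding i j, q.index_embedding i j⟩ : {x // q.index x = i})) ⟨?_, ?_⟩)).symm
  · intro j k h
    exact (q.embedding i).injective (congrArg Subtype.val h)
  · rintro ⟨x, rfl⟩
    exact ⟨q.invEmbedding x, Subtype.ext (q.embedding_comp_inv x)⟩

theorem Composition.index_surjective {n : ℕ} (q : Composition n) :
    Function.Surjective q.index := fun i =>
  ⟨q.embedding i ⟨0, q.one_le_blocksFun i⟩, q.index_embedding _ _⟩

theorem surjective_of_mem_rearrangements {n : ℕ} {α : Type*} {u h : Fin n → α}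
    (hu : Function.Surjective u) (hh : h ∈ rearrangements u) : Function.Surjective h := by
  obtain ⟨σ, rfl⟩ := mem_rearrangements.1 hh
  exact hu.comp σ.surjective

theorem numFactoring_of_length_eq_one (p : ℕ) {n : ℕ} {β : Type*} (c : Fin n → β)
    {q : Composition n} (hq : q.length = 1) : numFactoring p c q = 1 := by
  have : Subsingleton (Fin q.length) := by rw [hq]; infer_instance
  have heq : ((rearrangements q.index).filter fun h => h.FactorsThrough c) = {q.index} := by
    ext h
    rw [Finset.mem_filter, Finset.mem_singleton]
    refine ⟨fun _ => Subsingleton.elim _ _, ?_⟩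
    rintro rfl
    exact ⟨mem_rearrangements.2 ⟨1, rfl⟩, fun _ _ _ => Subsingleton.elim _ _⟩
  rw [numFactoring, heq, Finset.card_singleton, Nat.cast_one]

theorem numFactoring_eq_zero_of_card_lt_length (p : ℕ) {n : ℕ} {β : Type*} [Fintype β]
    {c : Fin n → β} (hc : Function.Surjective c) {q : Composition n}
    (hq : Fintype.card β < q.length) : numFactoring p c q = 0 := by
  rw [numFactoring, Finset.filter_false_of_mem, Finset.card_empty, Nat.cast_zero]
  intro h hh hf
  have hs := surjective_of_mem_rearrangements q.index_surjective hh
  have : Function.Surjective (h ∘ Function.surjInv hc) := fun i => by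
    obtain ⟨x, rfl⟩ := hs i
    exact ⟨c x, hf (Function.surjInv_eq hc _)⟩
  have := Fintype.card_le_of_surjective _ this
  rw [Fintype.card_fin] at this
  omega

theorem eq_or_eq_swap_comp_of_factorsThrough {ι : Type*} {u f : ι → Fin 2}
    (hu : Function.Surjective u) (hf : Function.Surjective f) (h : f.FactorsThrough u) :
    f = u ∨ f = Equiv.swap 0 1 ∘ u := by
  obtain ⟨x₀, h₀⟩ := hu 0
  obtain ⟨x₁, h₁⟩ := hu 1
  have key : ∀ x, f x = if u x = 0 then f x₀ else f x₁ := by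
    intro x
    split_ifs with hx
    · exact h (hx.trans h₀.symm)
    · exact h (by omega)
  have hne : f x₀ ≠ f x₁ := by
    intro he
    obtain ⟨y, hy⟩ := hf (f x₀ + 1)
    have := key y
    rw [he, ite_self, hy] at this
    omega
  rcases Fin.exists_fin_two.1 ⟨f x₀, rfl⟩ with h0 | h0
  · left
    funext x
    have := key x
    split_ifs at this <;> omega
  · right
    funext x
    have hx := key x
    rcases Fin.exists_fin_two.1 ⟨u x, rfl⟩ with h2 | h2
    · rw [if_pos h2] at hx
      rw [Function.comp_apply, h2, Equiv.swap_apply_left, hx, h0]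
    · rw [if_neg (by omega)] at hx
      rw [Function.comp_apply, h2, Equiv.swap_apply_right, hx]
      omega

theorem card_swap_comp_eq {ι : Type*} [Fintype ι] (u : ι → Fin 2) (i : Fin 2) :
    Fintype.card {x // (Equiv.swap 0 1 ∘ u) x = i} =
      Fintype.card {x // u x = Equiv.swap 0 1 i} :=
  Fintype.card_congr (Equiv.subtypeEquivRight fun x => by
    rw [Function.comp_apply, Equiv.swap_apply_eq_iff])

theorem card_fiber_zero_add_card_fiber_one {n : ℕ} (u : Fin n → Fin 2) :
    Fintype.card {x // u x = 0} + Fintype.card {x // u x = 1} = n := by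
  have := Fintype.card_congr (Equiv.sigmaFiberEquiv u)
  simpa [Fintype.card_sigma] using this

theorem mem_rearrangements_fin_two_iff {n : ℕ} {u h : Fin n → Fin 2} :
    h ∈ rearrangements u ↔ Fintype.card {x // h x = 0} = Fintype.card {x // u x = 0} := by
  rw [mem_rearrangements_iff_card, Fin.forall_fin_two]
  refine ⟨fun h => h.1, fun h0 => ⟨h0, ?_⟩⟩
  have h1 := card_fiber_zero_add_card_fiber_one h
  have h2 := card_fiber_zero_add_card_fiber_one u
  omega

theorem card_filter_factorsThrough_fin_two {n : ℕ} {u v : Fin n → Fin 2}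
    (hu : Function.Surjective u) (hv : Function.Surjective v)
    (hne : Fintype.card {x // u x = 0} ≠ Fintype.card {x // u x = 1}) :
    ((rearrangements v).filter fun h => h.FactorsThrough u).card =
      if Fintype.card {x // v x = 0} = Fintype.card {x // u x = 0} ∨
        Fintype.card {x // v x = 0} = Fintype.card {x // u x = 1} then 1 else 0 := by
  have hmem : ∀ h, h ∈ ((rearrangements v).filter fun h => h.FactorsThrough u) ↔
      (h = u ∧ Fintype.card {x // v x = 0} = Fintype.card {x // u x = 0}) ∨
      (h = Equiv.swap 0 1 ∘ u ∧ Fintype.card {x // v x = 0} = Fintype.card {x // u x = 1}) := by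
    intro h
    have hs := card_swap_comp_eq u 0
    rw [Equiv.swap_apply_left] at hs
    rw [Finset.mem_filter]
    constructor
    · rintro ⟨hh, hf⟩
      have := mem_rearrangements_fin_two_iff.1 hh
      rcases eq_or_eq_swap_comp_of_factorsThrough hu (surjective_of_mem_rearrangements hv hh) hf
        with rfl | rfl
      · exact Or.inl ⟨rfl, this.symm⟩
      · exact Or.inr ⟨rfl, this.symm.trans hs⟩
    · rintro (⟨rfl, hc⟩ | ⟨rfl, hc⟩)
      · exact ⟨mem_rearrangements_fin_two_iff.2 hc.symm, fun _ _ h => h⟩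
      · exact ⟨mem_rearrangements_fin_two_iff.2 (hs.trans hc.symm),
          fun _ _ h => congrArg (Equiv.swap 0 1) h⟩
  split_ifs with hc
  · rw [Finset.card_eq_one]
    rcases hc with hc | hc
    · refine ⟨u, Finset.ext fun h => ?_⟩
      simp only [hmem, hc, hne, and_true, and_false, or_false, Finset.mem_singleton]
    · refine ⟨Equiv.swap 0 1 ∘ u, Finset.ext fun h => ?_⟩
      simp only [hmem, hc, hne.symm, and_true, and_false, false_or, Finset.mem_singleton]
  · rw [Finset.card_eq_zero, Finset.eq_empty_iff_forall_notMem]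
    intro h
    rw [hmem]
    tauto

theorem numFactoring_two_parts (p : ℕ) {n : ℕ} {q r : Composition n} {a b d e : ℕ}
    (hq : q.blocks = [a, b]) (hr : r.blocks = [d, e]) (hab : a ≠ b) :
    numFactoring p q.index r = if d = a ∨ d = b then 1 else 0 := by
  obtain ⟨_, hq1, hq2⟩ := q
  obtain ⟨_, hr1, hr2⟩ := r
  subst hq hr
  set q : Composition n := ⟨[a, b], hq1, hq2⟩
  set r : Composition n := ⟨[d, e], hr1, hr2⟩
  have h0 : Fintype.card {x // (q.index : Fin n → Fin 2) x = 0} = a :=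
    q.card_index_eq (0 : Fin 2)
  have h1 : Fintype.card {x // (q.index : Fin n → Fin 2) x = 1} = b :=
    q.card_index_eq (1 : Fin 2)
  have h2 : Fintype.card {x // (r.index : Fin n → Fin 2) x = 0} = d :=
    r.card_index_eq (0 : Fin 2)
  have := card_filter_factorsThrough_fin_two (u := q.index) (v := r.index)
    q.index_surjective r.index_surjective (by rw [h0, h1]; exact hab)
  rw [h0, h1, h2] at this
  rw [numFactoring]
  refine (congrArg Nat.cast this).trans ?_
  split_ifs <;> simp

theorem Composition.exists_blocks_eq_of_length_eq_two {n : ℕ} {q : Composition n}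
    (hq : q.length = 2) : ∃ a b, q.blocks = [a, b] ∧ a + b = n := by
  obtain ⟨a, b, h⟩ := List.length_eq_two.1 hq
  refine ⟨a, b, h, ?_⟩
  have := q.blocks_sum
  simpa [h] using this

theorem coeff_eq_zero_of_length_eq_one {p n : ℕ} (hn : 1 ≤ n) {a : Composition n → ZMod p}
    (ha : ∀ {β : Type} (c : Fin n → β), ∑ q, a q * numFactoring p c q = 0)
    {q : Composition n} (hq : q.length = 1) : a q = 0 := by
  have h := ha (fun _ : Fin n => ())
  rw [Finset.sum_eq_single q] at h
  · rwa [numFactoring_of_length_eq_one p _ hq, mul_one] at h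
  · intro r _ hrq
    rw [numFactoring_eq_zero_of_card_lt_length, mul_zero]
    · exact fun _ => ⟨⟨0, hn⟩, rfl⟩
    · have h0 := r.length_pos_iff.2 hn
      have h1 : r.length ≠ 1 := fun h1 => hrq
        (((Composition.eq_single_iff_length hn).2 h1).trans
          ((Composition.eq_single_iff_length hn).2 hq).symm)
      rw [Fintype.card_unit]
      omega
  · simp

theorem coeff_add_coeff_reverse_eq_zero {p n : ℕ} (hn : 1 ≤ n) {a : Composition n → ZMod p}
    (ha : ∀ {β : Type} (c : Fin n → β), ∑ q, a q * numFactoring p c q = 0)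
    {q : Composition n} (hq : q.length = 2) (hrev : q.reverse ≠ q) :
    a q + a q.reverse = 0 := by
  obtain ⟨k, l, hkl, hsum⟩ := q.exists_blocks_eq_of_length_eq_two hq
  have hrb : q.reverse.blocks = [l, k] := by simp [Composition.reverse, hkl]
  have hne : k ≠ l := by
    rintro rfl
    exact hrev (Composition.ext (hrb.trans hkl.symm))
  have h := ha q.index
  rw [Finset.sum_eq_add q q.reverse hrev.symm] at h
  · rwa [numFactoring_two_parts p hkl hkl hne, numFactoring_two_parts p hkl hrb hne,
      if_pos (Or.inl rfl), if_pos (Or.inr rfl), mul_one, mul_one] at h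
  · rintro r _ ⟨h1, h2⟩
    have h0 := r.length_pos_iff.2 hn
    rcases (show r.length = 1 ∨ r.length = 2 ∨ 2 < r.length by omega) with hr | hr | hr
    · rw [coeff_eq_zero_of_length_eq_one hn ha hr, zero_mul]
    · obtain ⟨d, e, hde, hsum'⟩ := r.exists_blocks_eq_of_length_eq_two hr
      rw [numFactoring_two_parts p hkl hde hne, if_neg, mul_zero]
      rintro (rfl | rfl)
      · obtain rfl : e = l := by omega
        exact h1 (Composition.ext (hde.trans hkl.symm))
      · obtain rfl : e = k := by omega
        exact h2 (Composition.ext (hde.trans hrb.symm))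
    · rw [numFactoring_eq_zero_of_card_lt_length p q.index_surjective
        (by rw [Fintype.card_fin, hq]; exact hr), mul_zero]
  · simp
  · simp

/-- If `n` is even and `p = 2`, then
`R(n,2) ⊆ F_2·B̄_{[n/2,n/2]} + (Y_2 ∩ T) + Y_3`. -/
theorem stmt14 (n : ℕ) (hn : 1 ≤ n) (he : Even n) :
    descentRadicalSubmodule n 2 ≤
      Submodule.span (ZMod 2)
          {x | ∃ q : Composition n, q.blocks = [n / 2, n / 2] ∧ x = Bel n 2 q} ⊔
        (Ysub n 2 2 ⊓ Tsub n 2) ⊔ Ysub n 2 3 := by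
  intro x hx
  obtain ⟨a, rfl, ha⟩ := exists_coeffs_of_mem_descentRadicalSubmodule 2 hx
  rw [← Finset.sum_filter_not_add_sum_filter _ fun q : Composition n => 3 ≤ q.length]
  refine Submodule.add_mem_sup ?_ (Submodule.sum_mem _ fun q hq =>
    Submodule.smul_mem _ _ (Submodule.subset_span ⟨q, (Finset.mem_filter.1 hq).2, rfl⟩))
  rw [← Finset.sum_filter_add_sum_filter_not _
    fun q : Composition n => q.blocks = [n / 2, n / 2]]
  refine Submodule.add_mem_sup (Submodule.sum_mem _ fun q hq =>
    Submodule.smul_mem _ _ (Submodule.subset_span ⟨q, (Finset.mem_filter.1 hq).2, rfl⟩)) ?_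
  have hlen : ∀ q : Composition n, ¬ 3 ≤ q.length → q.length = 1 ∨ q.length = 2 := by
    intro q hq
    have := q.length_pos_iff.2 hn
    omega
  refine Submodule.mem_inf.2 ⟨Submodule.sum_mem _ fun q hq => ?_, ?_⟩
  · simp only [Finset.mem_filter, Finset.mem_univ, true_and] at hq
    rcases hlen q hq.1 with h | h
    · rw [coeff_eq_zero_of_length_eq_one hn ha h, zero_smul]
      exact Submodule.zero_mem _
    · exact Submodule.smul_mem _ _ (Submodule.subset_span ⟨q, h.ge, rfl⟩)
  · rw [← Submodule.Quotient.mk_eq_zero, ← Submodule.mkQ_apply, map_sum]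
    have hrev : ∀ q : Composition n, q.length = 2 → q.blocks ≠ [n / 2, n / 2] →
        q.reverse ≠ q := by
      intro q hq hne heq
      obtain ⟨k, l, hkl, hsum⟩ := q.exists_blocks_eq_of_length_eq_two hq
      have h1 := congrArg Composition.blocks heq
      simp only [Composition.reverse, hkl, List.reverse_cons, List.reverse_nil, List.nil_append,
        List.cons_append, List.cons.injEq, and_true] at h1
      obtain rfl := h1.1
      exact hne (by rw [hkl, show n / 2 = l by omega])
    refine Finset.sum_involution (fun q _ => q.reverse) ?_ ?_ ?_ ?_
    · intro q hq
      simp only [Finset.mem_filter, Finset.mem_univ, true_and] at hq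
      rcases hlen q hq.1 with h | h
      · have h' : q.reverse.length = 1 := by
          simpa [Composition.length, Composition.reverse] using h
        rw [coeff_eq_zero_of_length_eq_one hn ha h, coeff_eq_zero_of_length_eq_one hn ha h',
          zero_smul, zero_smul, map_zero, add_zero]
      · have hB : (Tsub n 2).mkQ (Bel n 2 q) = (Tsub n 2).mkQ (Bel n 2 q.reverse) := by
          rw [Submodule.mkQ_apply, Submodule.mkQ_apply, Submodule.Quotient.eq]
          exact Submodule.subset_span ⟨q, q.reverse, (List.reverse_perm _).symm, rfl⟩
        rw [map_smul, map_smul, hB, ← add_smul,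
          coeff_add_coeff_reverse_eq_zero hn ha h (hrev q h hq.2), zero_smul]
    · intro q hq hne
      simp only [Finset.mem_filter, Finset.mem_univ, true_and] at hq
      rcases hlen q hq.1 with h | h
      · rw [coeff_eq_zero_of_length_eq_one hn ha h, zero_smul, map_zero] at hne
        exact absurd rfl hne
      · exact hrev q h hq.2
    · intro q hq
      simp only [Finset.mem_filter, Finset.mem_univ, true_and] at hq ⊢
      refine ⟨by simpa [Composition.length, Composition.reverse] using hq.1, fun h => hq.2 ?_⟩
      have := congrArg List.reverse h
      simpa [Composition.reverse] using this
    · intro q _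
      exact q.reverse_reverse

end
end

section
/- For every n ≥ 3 and every prime p, the nilpotency index of the Jacobson radical R(n,p) of Σ(n,p) is exactly n − 1; that is, R(n,p)^{n−1} = 0 but R(n,p)^{n−2} ≠ 0. -/
open scoped Classical

set_option synthInstance.maxHeartbeats 1000000
set_option maxHeartbeats 1000000

noncomputable section

namespace DescentAlgebra

open Finset

variable {n : ℕ}

/-- `σ` is increasing at every adjacent pair of positions not cut by `S`. -/
def Asc (σ : Equiv.Perm (Fin n)) (S : Finset ℕ) : Prop :=
  ∀ i j : Fin n, (j : ℕ) = i + 1 → (j : ℕ) ∉ S → σ i < σ j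

/-- `g` is weakly increasing at every adjacent pair of positions not cut by `Q`. -/
def Weak (g : Fin n → ℕ) (Q : Finset ℕ) : Prop :=
  ∀ i j : Fin n, (j : ℕ) = i + 1 → (j : ℕ) ∉ Q → g i ≤ g j

/-- The positions at which `g` changes its value. -/
def jump (g : Fin n → ℕ) : Finset ℕ :=
  (Ico 1 n).filter fun k => ∃ i j : Fin n, (j : ℕ) = k ∧ (i : ℕ) + 1 = k ∧ g i ≠ g j

/-- The index of the block of `S` in which a position lies. -/
def blk (n : ℕ) (S : Finset ℕ) (k : Fin n) : ℕ := #{s ∈ S | s ≤ (k : ℕ)}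

/-- All rearrangements of the word `blk n S`. -/
def words (n : ℕ) (S : Finset ℕ) : Finset (Fin n → ℕ) :=
  univ.image fun π : Equiv.Perm (Fin n) => blk n S ∘ π

/-- The sum of all permutations whose descents lie in `S`. -/
def B (n p : ℕ) (S : Finset ℕ) : GroupAlg n p :=
  ∑ σ : Equiv.Perm (Fin n), if Asc σ S then MonoidAlgebra.single σ 1 else 0

lemma descSet_subset_iff (σ : Equiv.Perm (Fin n)) (S : Finset ℕ) :
    descSet σ ⊆ (S : Set ℕ) ↔ Asc σ S := by
  constructor
  · intro h i j hij hj
    by_contra hlt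
    have hne : σ i ≠ σ j := fun e => by
      have := σ.injective e
      subst this; omega
    refine hj (h ⟨j.2, by omega, ?_⟩)
    have : (⟨(j : ℕ) - 1, by omega⟩ : Fin n) = i := Fin.ext (by simp [hij])
    rw [this]
    exact lt_of_le_of_ne (not_lt.1 hlt) hne.symm
  · rintro h k ⟨hk, hk0, hlt⟩
    by_contra hS
    exact lt_asymm hlt (h ⟨k - 1, by omega⟩ ⟨k, hk⟩ (by simp; omega) hS)

lemma blk_mono (S : Finset ℕ) : Monotone (blk n S) := fun i j hij =>
  card_le_card fun s hs => by
    have hij' : (i : ℕ) ≤ j := hij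
    simp only [mem_filter] at hs ⊢
    exact ⟨hs.1, hs.2.trans hij'⟩

lemma blk_lt_of_mem {S : Finset ℕ} {i j : Fin n} {s : ℕ} (hs : s ∈ S) (his : (i : ℕ) < s)
    (hsj : s ≤ (j : ℕ)) : blk n S i < blk n S j := by
  refine card_lt_card (Finset.ssubset_iff_subset_ne.2 ⟨fun t ht => ?_, fun e => ?_⟩)
  · simp only [mem_filter] at ht ⊢
    exact ⟨ht.1, by omega⟩
  · have : s ∈ ({s ∈ S | s ≤ (i : ℕ)} : Finset ℕ) := by rw [e]; simp [hs, hsj]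
    simp only [mem_filter] at this
    omega

lemma blk_eq_of_forall {S : Finset ℕ} {i j : Fin n}
    (h : ∀ s ∈ S, s ≤ (i : ℕ) ↔ s ≤ (j : ℕ)) : blk n S i = blk n S j := by
  unfold blk
  congr 1
  exact filter_congr h

lemma sort_inv_lt_iff (f : Fin n → ℕ) (x y : Fin n) :
    (Tuple.sort f)⁻¹ x < (Tuple.sort f)⁻¹ y ↔ f x < f y ∨ f x = f y ∧ x < y := by
  obtain ⟨hm, hs⟩ := Tuple.eq_sort_iff.1 (rfl : Tuple.sort f = Tuple.sort f)
  have key : ∀ x y, (Tuple.sort f)⁻¹ x < (Tuple.sort f)⁻¹ y → f x < f y ∨ f x = f y ∧ x < y := by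
    intro x y h
    have h1 := hm h.le
    have h2 := hs _ _ h
    simp only [Function.comp_apply, ← Equiv.Perm.mul_apply, mul_inv_cancel, Equiv.Perm.one_apply] at h1 h2
    rcases h1.lt_or_eq with h1 | h1
    · exact Or.inl h1
    · exact Or.inr ⟨h1, h2 h1⟩
  refine ⟨key x y, fun h => ?_⟩
  by_contra hn
  rcases (not_lt.1 hn).lt_or_eq with h' | h'
  · have := key y x h'
    omega
  · have := (Tuple.sort f)⁻¹.injective h'
    subst this
    simp at h

lemma rel_of_adjacent {r : Fin n → Fin n → Prop} (hr : ∀ i j k, r i j → r j k → r i k)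
    {S : Finset ℕ} (h : ∀ i j : Fin n, (j : ℕ) = i + 1 → (j : ℕ) ∉ S → r i j) (i : Fin n) :
    ∀ (d : ℕ) (j : Fin n), (j : ℕ) = i + d + 1 → (∀ s ∈ S, (i : ℕ) < s → (j : ℕ) < s) →
      r i j := by
  intro d
  induction d with
  | zero =>
    intro j hj hS
    exact h i j hj fun hm => lt_irrefl _ (hS _ hm (by omega))
  | succ d ih =>
    intro j hj hS
    have hlt : (j : ℕ) - 1 < n := by omega
    refine hr _ _ _ (ih ⟨j - 1, hlt⟩ (by simp; omega) fun s hs his => ?_)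
      (h ⟨j - 1, hlt⟩ j (by simp; omega) fun hm => lt_irrefl _ (hS _ hm (by omega)))
    have := hS s hs his
    simp; omega

lemma asc_iff_eq_sort (σ : Equiv.Perm (Fin n)) (S : Finset ℕ) :
    Asc σ S ↔ σ = Tuple.sort (blk n S ∘ ⇑σ⁻¹) := by
  rw [Tuple.eq_sort_iff]
  have hc : (blk n S ∘ ⇑σ⁻¹) ∘ ⇑σ = blk n S := by ext; simp
  rw [hc]
  simp only [Function.comp_apply, ← Equiv.Perm.mul_apply, inv_mul_cancel, Equiv.Perm.one_apply]
  constructor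
  · refine fun h => ⟨blk_mono S, fun i j hij he => ?_⟩
    have hij' : (i : ℕ) < j := hij
    refine rel_of_adjacent (r := fun i j => σ i < σ j) (fun _ _ _ => lt_trans) h i (j - i - 1) j (by omega) fun s hs his => ?_
    by_contra hsj
    exact (blk_lt_of_mem hs his (not_lt.1 hsj)).ne he
  · rintro ⟨-, h⟩ i j hij hj
    refine h i j (by rw [Fin.lt_def]; omega) (blk_eq_of_forall fun s hs => ?_)
    have : s ≠ j := fun e => hj (e ▸ hs)
    omega

lemma mem_words {S : Finset ℕ} {g : Fin n → ℕ} :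
    g ∈ words n S ↔ ∃ π : Equiv.Perm (Fin n), blk n S ∘ π = g := by
  simp [words]

lemma words_comp {S : Finset ℕ} {g : Fin n → ℕ} (hg : g ∈ words n S) (ρ : Equiv.Perm (Fin n)) :
    g ∘ ρ ∈ words n S := by
  obtain ⟨π, rfl⟩ := mem_words.1 hg
  exact mem_words.2 ⟨π * ρ, rfl⟩

lemma comp_sort_of_mem_words {S : Finset ℕ} {f : Fin n → ℕ} (hf : f ∈ words n S) :
    f ∘ Tuple.sort f = blk n S := by
  obtain ⟨π, rfl⟩ := mem_words.1 hf
  have h := Tuple.monotone_sort (blk n S ∘ ⇑π)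
  exact Tuple.unique_monotone (f := blk n S) (σ := π * Tuple.sort (blk n S ∘ ⇑π)) (τ := 1)
    h (blk_mono S)

lemma B_eq_sum_sort (p : ℕ) (S : Finset ℕ) :
    B n p S = ∑ f ∈ words n S, MonoidAlgebra.single (Tuple.sort f) 1 := by
  unfold B
  rw [← sum_filter]
  refine sum_bij' (fun σ _ => blk n S ∘ ⇑σ⁻¹) (fun f _ => Tuple.sort f) ?_ ?_ ?_ ?_ ?_
  · exact fun σ _ => mem_words.2 ⟨σ⁻¹, rfl⟩
  · intro f hf
    have h := comp_sort_of_mem_words hf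
    have h' : blk n S ∘ ⇑(Tuple.sort f)⁻¹ = f := by
      rw [← h]; ext; simp
    simp only [mem_filter, mem_univ, true_and]
    rw [asc_iff_eq_sort, h']
  · intro σ hσ
    exact ((asc_iff_eq_sort σ S).1 (by simpa using hσ)).symm
  · intro f hf
    rw [← comp_sort_of_mem_words hf]; ext; simp
  · intro σ hσ
    rw [← (asc_iff_eq_sort σ S).1 (by simpa using hσ)]

lemma mem_jump_iff {g : Fin n → ℕ} {i j : Fin n} (hij : (j : ℕ) = i + 1) :
    (j : ℕ) ∈ jump g ↔ g i ≠ g j := by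
  simp only [jump, mem_filter, mem_Ico]
  refine ⟨?_, fun h => ⟨⟨by omega, j.2⟩, i, j, rfl, hij.symm, h⟩⟩
  rintro ⟨-, i', j', hj, hi, h⟩
  rwa [show i = i' from Fin.ext (by omega), show j = j' from Fin.ext (by omega)]

lemma asc_sort_inv_mul (g : Fin n → ℕ) (ρ : Equiv.Perm (Fin n)) (Q : Finset ℕ) :
    Asc ((Tuple.sort (g ∘ ⇑ρ⁻¹))⁻¹ * ρ) Q ↔ Weak g Q ∧ Asc ρ (Q ∪ jump g) := by
  have key : ∀ i j, ((Tuple.sort (g ∘ ⇑ρ⁻¹))⁻¹ * ρ) i < ((Tuple.sort (g ∘ ⇑ρ⁻¹))⁻¹ * ρ) j ↔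
      g i < g j ∨ g i = g j ∧ ρ i < ρ j := by
    intro i j
    rw [Equiv.Perm.mul_apply, Equiv.Perm.mul_apply, sort_inv_lt_iff]
    simp
  simp only [Asc, Weak, key, mem_union, not_or]
  constructor
  · refine fun h => ⟨fun i j hij hj => ?_, fun i j hij hj => ?_⟩
    · rcases h i j hij hj with h | h <;> omega
    · have h1 := h i j hij hj.1
      have h2 := hj.2
      rw [mem_jump_iff hij, not_not] at h2
      rcases h1 with h1 | h1
      · omega
      · exact h1.2
  · rintro ⟨h1, h2⟩ i j hij hj
    rcases (h1 i j hij hj).lt_or_eq with h | h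
    · exact Or.inl h
    · exact Or.inr ⟨h, h2 i j hij ⟨hj, by rw [mem_jump_iff hij, not_not]; exact h⟩⟩

/-- The multiplication rule of the descent algebra. -/
theorem B_mul_B (p : ℕ) (S Q : Finset ℕ) :
    B n p S * B n p Q = ∑ g ∈ words n S, if Weak g Q then B n p (Q ∪ jump g) else 0 := by
  have h1 : ∀ f : Fin n → ℕ, (MonoidAlgebra.single (Tuple.sort f) 1 : GroupAlg n p) * B n p Q =
      ∑ ρ : Equiv.Perm (Fin n),
        if Asc ((Tuple.sort f)⁻¹ * ρ) Q then MonoidAlgebra.single ρ 1 else 0 := by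
    intro f
    rw [← Equiv.sum_comp (Equiv.mulLeft (Tuple.sort f)), B, mul_sum]
    refine sum_congr rfl fun τ _ => ?_
    simp [MonoidAlgebra.single_mul_single, mul_ite]
  have h2 : ∀ ρ : Equiv.Perm (Fin n), (∑ f ∈ words n S,
      if Asc ((Tuple.sort f)⁻¹ * ρ) Q then (MonoidAlgebra.single ρ 1 : GroupAlg n p) else 0) =
      ∑ g ∈ words n S, if Weak g Q ∧ Asc ρ (Q ∪ jump g) then MonoidAlgebra.single ρ 1 else 0 := by
    intro ρ
    refine sum_bij' (fun f _ => f ∘ ρ) (fun g _ => g ∘ ⇑ρ⁻¹) (fun f hf => words_comp hf ρ)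
      (fun g hg => words_comp hg ρ⁻¹) (fun f _ => by ext; simp) (fun g _ => by ext; simp) ?_
    intro f _
    have : (f ∘ ⇑ρ) ∘ ⇑ρ⁻¹ = f := by ext; simp
    exact if_congr (by rw [← asc_sort_inv_mul, this]) rfl rfl
  rw [B_eq_sum_sort p S, sum_mul, sum_congr rfl fun f _ => h1 f, sum_comm,
    sum_congr rfl fun ρ _ => h2 ρ, sum_comm]
  refine sum_congr rfl fun g _ => ?_
  by_cases hw : Weak g Q <;> simp [hw, B]

lemma B_empty (p : ℕ) : B n p ∅ = 1 := by
  have h : ∀ σ : Equiv.Perm (Fin n), Asc σ ∅ ↔ σ = 1 := by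
    intro σ
    have hm : Monotone (blk n ∅ ∘ ⇑σ⁻¹) := fun i j _ => by simp [blk]
    rw [asc_iff_eq_sort, Tuple.sort_eq_refl_iff_monotone.2 hm]
    rfl
  simp only [B, h]
  rw [sum_ite_eq' univ (1 : Equiv.Perm (Fin n)) fun σ => (MonoidAlgebra.single σ 1 : GroupAlg n p)]
  simp [MonoidAlgebra.one_def]

/-- A permutation with descent set `T`. -/
def descPerm (n : ℕ) (T : Finset ℕ) : Equiv.Perm (Fin n) :=
  (Tuple.sort fun k : Fin n => #T - blk n T k)⁻¹

lemma asc_descPerm_iff {T : Finset ℕ} (hT : T ⊆ Ico 1 n) (S : Finset ℕ) :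
    Asc (descPerm n T) S ↔ T ⊆ S := by
  have key : ∀ i j : Fin n, (j : ℕ) = i + 1 →
      (descPerm n T i < descPerm n T j ↔ (j : ℕ) ∉ T) := by
    intro i j hij
    have hij' : i < j := by rw [Fin.lt_def]; omega
    have hle : blk n T j ≤ #T := card_filter_le _ _
    rw [descPerm, sort_inv_lt_iff]
    constructor
    · intro h hj
      have := blk_lt_of_mem (i := i) (j := j) hj (by omega) le_rfl
      omega
    · intro hj
      refine Or.inr ⟨?_, hij'⟩
      rw [blk_eq_of_forall (i := i) (j := j)]
      intro s hs
      have : s ≠ j := fun e => hj (e ▸ hs)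
      omega
  constructor
  · intro h t ht
    by_contra hS
    have := mem_Ico.1 (hT ht)
    have h' := h ⟨t - 1, by omega⟩ ⟨t, this.2⟩ (by simp; omega) hS
    rw [key _ _ (by simp; omega)] at h'
    exact h' ht
  · intro h i j hij hj
    exact (key i j hij).2 fun hT => hj (h hT)

/-- The coefficient of a permutation, as a linear functional. -/
def coeffAt (p : ℕ) (ρ : Equiv.Perm (Fin n)) : GroupAlg n p →ₗ[ZMod p] ZMod p where
  toFun x := x.coeff ρ
  map_add' _ _ := rfl
  map_smul' _ _ := rfl

lemma coeffAt_single (p : ℕ) (ρ σ : Equiv.Perm (Fin n)) :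
    coeffAt p ρ (MonoidAlgebra.single σ 1) = if σ = ρ then 1 else 0 :=
  Finsupp.single_apply

lemma coeffAt_B (p : ℕ) (ρ : Equiv.Perm (Fin n)) (S : Finset ℕ) :
    coeffAt p ρ (B n p S) = if Asc ρ S then 1 else 0 := by
  have h : ∀ σ : Equiv.Perm (Fin n), coeffAt p ρ (if Asc σ S then MonoidAlgebra.single σ 1 else 0) =
      if σ = ρ then (if Asc ρ S then 1 else 0) else 0 := by
    intro σ
    by_cases e : σ = ρ
    · subst e
      by_cases hA : Asc σ S <;> simp [hA, coeffAt_single]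
    · by_cases hA : Asc σ S <;> simp [hA, coeffAt_single, e]
  rw [B, map_sum, sum_congr rfl fun σ _ => h σ, sum_ite_eq' univ ρ fun _ => _]
  simp

/-- The functional dual to `B n p Q`. -/
def dual (n p : ℕ) (Q : Finset ℕ) : GroupAlg n p →ₗ[ZMod p] ZMod p :=
  ∑ U ∈ (Ico 1 n \ Q).powerset, ((-1 : ZMod p) ^ #U) • coeffAt p (descPerm n (Q ∪ U))

lemma dual_B (p : ℕ) {Q S : Finset ℕ} (hQ : Q ⊆ Ico 1 n) (hS : S ⊆ Ico 1 n) :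
    dual n p Q (B n p S) = if S = Q then 1 else 0 := by
  have h1 : dual n p Q (B n p S) =
      ∑ U ∈ (Ico 1 n \ Q).powerset, if Q ∪ U ⊆ S then (-1 : ZMod p) ^ #U else 0 := by
    rw [dual, LinearMap.sum_apply]
    refine sum_congr rfl fun U hU => ?_
    have hU' : Q ∪ U ⊆ Ico 1 n :=
      union_subset hQ ((mem_powerset.1 hU).trans sdiff_subset)
    rw [LinearMap.smul_apply, coeffAt_B, if_congr (asc_descPerm_iff hU' S) rfl rfl]
    simp
  rw [h1, ← sum_filter]
  by_cases hQS : Q ⊆ S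
  · have h2 : ((Ico 1 n \ Q).powerset.filter fun U => Q ∪ U ⊆ S) = (S \ Q).powerset := by
      ext U
      simp only [mem_filter, mem_powerset, union_subset_iff, subset_sdiff]
      constructor
      · rintro ⟨⟨_, hd⟩, _, hU⟩
        exact ⟨hU, hd⟩
      · rintro ⟨hU, hd⟩
        exact ⟨⟨hU.trans hS, hd⟩, hQS, hU⟩
    have h3 := congrArg (Int.cast : ℤ → ZMod p) (sum_powerset_neg_one_pow_card (x := S \ Q))
    push_cast at h3
    rw [h2, h3]
    refine if_congr ?_ rfl rfl
    rw [sdiff_eq_empty_iff_subset]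
    exact ⟨fun h => subset_antisymm h hQS, fun h => h.subset⟩
  · rw [if_neg (fun h => hQS h.symm.subset), sum_eq_zero]
    intro U hU
    exact absurd (subset_union_left.trans (mem_filter.1 hU).2) hQS

/-- The span of the `B n p S` with `#S ≥ j`. -/
def Y (n p j : ℕ) : Submodule (ZMod p) (GroupAlg n p) :=
  Submodule.span (ZMod p) {x | ∃ S ⊆ Ico 1 n, j ≤ #S ∧ x = B n p S}

lemma B_mem_Y {p j : ℕ} {S : Finset ℕ} (hS : S ⊆ Ico 1 n) (hj : j ≤ #S) : B n p S ∈ Y n p j :=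
  Submodule.subset_span ⟨S, hS, hj, rfl⟩

lemma Y_anti (p : ℕ) {j k : ℕ} (h : j ≤ k) : Y n p k ≤ Y n p j :=
  Submodule.span_mono fun _ ⟨S, hS, hk, e⟩ => ⟨S, hS, h.trans hk, e⟩

lemma Y_induction {p j : ℕ} {C : GroupAlg n p → Prop}
    (hB : ∀ S ⊆ Ico 1 n, j ≤ #S → C (B n p S)) (h0 : C 0) (hadd : ∀ x y, C x → C y → C (x + y))
    (hsmul : ∀ (a : ZMod p) x, C x → C (a • x)) {x : GroupAlg n p} (hx : x ∈ Y n p j) : C x := by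
  induction hx using Submodule.span_induction with
  | mem x h => obtain ⟨S, hS, hj, rfl⟩ := h; exact hB S hS hj
  | zero => exact h0
  | add x y _ _ hx hy => exact hadd x y hx hy
  | smul a x _ hx => exact hsmul a x hx

lemma Y_eq_zero {p j : ℕ} (hj : n ≤ j) (hn : 1 ≤ n) {x : GroupAlg n p} (hx : x ∈ Y n p j) :
    x = 0 := by
  refine Y_induction (C := fun x => x = 0) (fun S hS hjS => ?_) rfl ?_ ?_ hx
  · have := card_le_card hS
    rw [Nat.card_Ico] at this
    omega
  · rintro _ _ rfl rfl; simp
  · rintro _ _ rfl; simp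

lemma jump_subset (g : Fin n → ℕ) : jump g ⊆ Ico 1 n := filter_subset _ _

lemma one_mem_Y (p : ℕ) : (1 : GroupAlg n p) ∈ Y n p 0 :=
  B_empty (n := n) p ▸ B_mem_Y (empty_subset _) (Nat.zero_le _)

lemma mul_mem_Y {p j : ℕ} {x y : GroupAlg n p} (hx : x ∈ Y n p 0) (hy : y ∈ Y n p j) :
    x * y ∈ Y n p j := by
  refine Y_induction (C := fun x => x * y ∈ Y n p j) (fun S hS _ => ?_) (by simp)
    (fun a b ha hb => by rw [add_mul]; exact add_mem ha hb)
    (fun a x hx => by rw [smul_mul_assoc]; exact Submodule.smul_mem _ _ hx) hx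
  refine Y_induction (C := fun y => B n p S * y ∈ Y n p j) (fun Q hQ hj => ?_) (by simp)
    (fun a b ha hb => by rw [mul_add]; exact add_mem ha hb)
    (fun a x hx => by rw [mul_smul_comm]; exact Submodule.smul_mem _ _ hx) hy
  rw [B_mul_B]
  refine sum_mem fun g _ => ?_
  split_ifs
  · exact B_mem_Y (union_subset hQ (jump_subset g)) (hj.trans (card_le_card subset_union_left))
  · exact zero_mem _

lemma mem_properPartialSums {q : Composition n} {m : ℕ} :
    m ∈ properPartialSums q ↔ ∃ h : m ∈ Ico 1 n,
      (⟨m, Nat.lt_succ_of_lt (mem_Ico.1 h).2⟩ : Fin (n + 1)) ∈ q.boundaries := by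
  simp only [Composition.boundaries, mem_map, mem_univ, true_and]
  constructor
  · rintro ⟨i, hi0, hil, rfl⟩
    have h1 : 0 < q.sizeUpTo i :=
      (Nat.zero_le _).trans_lt ((q.sizeUpTo_strict_mono (i := 0) (hi0.trans hil)).trans_le
        (q.monotone_sizeUpTo (by omega)))
    have h2 : q.sizeUpTo i < n :=
      (q.sizeUpTo_strict_mono hil).trans_le (q.sizeUpTo_le _)
    exact ⟨mem_Ico.2 ⟨h1, h2⟩, ⟨i, by omega⟩, rfl⟩
  · rintro ⟨hm, i, hi⟩
    have hi' : q.sizeUpTo i = m := congrArg Fin.val hi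
    have hm' := mem_Ico.1 hm
    refine ⟨i, Nat.pos_of_ne_zero fun h => ?_, lt_of_le_of_ne (by omega) fun h => ?_, hi'.symm⟩
    · rw [h, q.sizeUpTo_zero] at hi'; omega
    · rw [h, q.sizeUpTo_length] at hi'; omega

lemma Bel_eq_B {p : ℕ} {q : Composition n} {S : Finset ℕ}
    (h : properPartialSums q = (S : Set ℕ)) : Bel n p q = B n p S := by
  rw [Bel, B, sum_filter]
  refine sum_congr rfl fun σ _ => if_congr ?_ rfl rfl
  rw [h, descSet_subset_iff]

lemma range_Bel (n p : ℕ) :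
    Set.range (Bel n p) = {x | ∃ S ⊆ Ico 1 n, 0 ≤ #S ∧ x = B n p S} := by
  ext x
  constructor
  · rintro ⟨q, rfl⟩
    refine ⟨(Ico 1 n).filter (· ∈ properPartialSums q), filter_subset _ _, Nat.zero_le _,
      Bel_eq_B (Set.ext fun m => ?_)⟩
    simp only [coe_filter, Set.mem_ofPred_eq, iff_and_self]
    exact fun h => (mem_properPartialSums.1 h).1
  · rintro ⟨S, hS, -, rfl⟩
    let c : CompositionAsSet n :=
      { boundaries := univ.filter fun k : Fin (n + 1) => (k : ℕ) ∈ S ∨ k = 0 ∨ k = Fin.last n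
        zero_mem := by simp
        getLast_mem := by simp }
    refine ⟨c.toComposition, Bel_eq_B (Set.ext fun m => ?_)⟩
    rw [mem_properPartialSums, CompositionAsSet.toComposition_boundaries]
    simp only [c, mem_filter, mem_univ, true_and, mem_coe, Fin.ext_iff, Fin.val_zero, Fin.val_last]
    constructor
    · rintro ⟨h, h'⟩
      have := mem_Ico.1 h
      rcases h' with h' | h' | h'
      · exact h'
      · omega
      · omega
    · exact fun h => ⟨hS h, Or.inl h⟩

lemma mem_descentAlgebra_iff {p : ℕ} {x : GroupAlg n p} :
    x ∈ descentAlgebra n p ↔ x ∈ Y n p 0 := by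
  have hr := range_Bel n p
  constructor
  · intro hx
    induction hx using Algebra.adjoin_induction with
    | mem x h => exact Submodule.subset_span (hr ▸ h)
    | algebraMap r =>
      rw [Algebra.algebraMap_eq_smul_one]
      exact Submodule.smul_mem _ _ (one_mem_Y p)
    | add x y _ _ hx hy => exact add_mem hx hy
    | mul x y _ _ hx hy => exact mul_mem_Y hx hy
  · intro hx
    have := Algebra.span_le_adjoin (ZMod p) (Set.range (Bel n p))
    refine this ?_
    rw [hr]
    exact hx

lemma weak_of_jump_subset {g : Fin n → ℕ} {Q : Finset ℕ} (h : jump g ⊆ Q) : Weak g Q := by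
  intro i j hij hj
  by_contra hlt
  exact hj (h ((mem_jump_iff hij).2 fun e => hlt e.le))

lemma dual_eq_zero {p : ℕ} {Q : Finset ℕ} (hQ : Q ⊆ Ico 1 n) {x : GroupAlg n p}
    (hx : x ∈ Y n p (#Q + 1)) : dual n p Q x = 0 := by
  refine Y_induction (C := fun x => dual n p Q x = 0) (fun S hS hj => ?_) (map_zero _)
    (fun a b ha hb => by rw [map_add, ha, hb, add_zero])
    (fun a x hx => by rw [map_smul, hx, smul_zero]) hx
  rw [dual_B p hQ hS, if_neg]
  rintro rfl
  omega

lemma dual_B_mul_B (p : ℕ) (S : Finset ℕ) {Q : Finset ℕ} (hQ : Q ⊆ Ico 1 n) :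
    dual n p Q (B n p S * B n p Q) = ∑ g ∈ words n S, if jump g ⊆ Q then 1 else 0 := by
  rw [B_mul_B, map_sum]
  refine sum_congr rfl fun g _ => ?_
  by_cases hj : jump g ⊆ Q
  · rw [if_pos hj, if_pos (weak_of_jump_subset hj), dual_B p hQ (union_subset hQ (jump_subset g)),
      if_pos (union_eq_left.2 hj)]
  · rw [if_neg hj]
    split_ifs
    · rw [dual_B p hQ (union_subset hQ (jump_subset g)), if_neg fun h => hj (union_eq_left.1 h)]
    · exact map_zero _

lemma mul_B_sub_mem_Y {p : ℕ} {x : GroupAlg n p} (hx : x ∈ Y n p 0) {Q : Finset ℕ}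
    (hQ : Q ⊆ Ico 1 n) : x * B n p Q - dual n p Q (x * B n p Q) • B n p Q ∈ Y n p (#Q + 1) := by
  refine Y_induction (C := fun x => x * B n p Q - dual n p Q (x * B n p Q) • B n p Q ∈
    Y n p (#Q + 1)) (fun S hS _ => ?_) (by simp) (fun a b ha hb => ?_) (fun a x hx => ?_) hx
  · rw [dual_B_mul_B p S hQ, B_mul_B, sum_smul, ← sum_sub_distrib]
    refine sum_mem fun g _ => ?_
    by_cases hj : jump g ⊆ Q
    · rw [if_pos hj, if_pos (weak_of_jump_subset hj), union_eq_left.2 hj, one_smul, sub_self]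
      exact zero_mem _
    · rw [if_neg hj, zero_smul, sub_zero]
      split_ifs
      · refine B_mem_Y (union_subset hQ (jump_subset g)) (card_lt_card ?_)
        refine Finset.ssubset_iff_subset_ne.2 ⟨subset_union_left, fun h => hj ?_⟩
        exact union_eq_left.1 h.symm
      · exact zero_mem _
  · rw [add_mul, map_add, add_smul, add_sub_add_comm]
    exact add_mem ha hb
  · rw [smul_mul_assoc, map_smul, smul_assoc, ← smul_sub]
    exact Submodule.smul_mem _ _ hx

lemma mul_mem_Y_succ {p j : ℕ} {x y : GroupAlg n p} (hx : x ∈ Y n p 0)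
    (h : ∀ Q ⊆ Ico 1 n, dual n p Q (x * B n p Q) = 0) (hy : y ∈ Y n p j) :
    x * y ∈ Y n p (j + 1) := by
  refine Y_induction (C := fun y => x * y ∈ Y n p (j + 1)) (fun Q hQ hj => ?_) (by simp)
    (fun a b ha hb => by rw [mul_add]; exact add_mem ha hb)
    (fun a x hx => by rw [mul_smul_comm]; exact Submodule.smul_mem _ _ hx) hy
  have := mul_B_sub_mem_Y hx hQ
  rw [h Q hQ, zero_smul, sub_zero] at this
  exact Y_anti p (by omega) this

lemma mem_Y_of_mem {p : ℕ} (x : descentAlgebra n p) : (x : GroupAlg n p) ∈ Y n p 0 :=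
  mem_descentAlgebra_iff.1 x.2

lemma dual_mul_eq_zero_of_mem_radical {p : ℕ} [Fact p.Prime] {x : descentAlgebra n p}
    (hx : x ∈ descentRadical n p) {Q : Finset ℕ} (hQ : Q ⊆ Ico 1 n) :
    dual n p Q (x * B n p Q) = 0 := by
  by_contra hne
  set c := dual n p Q (x * B n p Q) with hc
  obtain ⟨z, hz⟩ := Ideal.mem_jacobson_iff.1 hx (algebraMap _ _ (-c⁻¹))
  rw [Ideal.mem_bot, sub_eq_zero] at hz
  have hz' : (z : GroupAlg n p) * (1 - c⁻¹ • (x : GroupAlg n p)) = 1 := by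
    have h1 : z * (1 - c⁻¹ • x) = 1 := by
      refine Eq.trans ?_ hz
      rw [Algebra.algebraMap_eq_smul_one, mul_sub, mul_one, mul_smul_comm, mul_smul_comm,
        mul_one, smul_mul_assoc, neg_smul]
      abel
    exact congrArg Subtype.val h1
  have h1 : (1 - c⁻¹ • (x : GroupAlg n p)) * B n p Q ∈ Y n p (#Q + 1) := by
    have h2 := Submodule.smul_mem _ (-c⁻¹) (mul_B_sub_mem_Y (mem_Y_of_mem x) hQ)
    rw [← hc, smul_sub, smul_smul, neg_mul, inv_mul_cancel₀ hne] at h2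
    convert h2 using 1
    rw [sub_mul, one_mul, smul_mul_assoc, neg_smul, neg_smul, one_smul]
    abel
  have h3 := mul_mem_Y (mem_Y_of_mem z) h1
  rw [← mul_assoc, hz', one_mul] at h3
  have h4 := dual_eq_zero hQ h3
  rw [dual_B p hQ hQ, if_pos rfl] at h4
  exact one_ne_zero h4

lemma mul_mem_Y_of_mem_radical_pow {p : ℕ} [Fact p.Prime] (k : ℕ) :
    ∀ {x : descentAlgebra n p}, x ∈ descentRadical n p ^ k → ∀ {j : ℕ} {y : GroupAlg n p},
      y ∈ Y n p j → (x : GroupAlg n p) * y ∈ Y n p (j + k) := by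
  induction k with
  | zero => exact fun {x} _ j y hy => mul_mem_Y (mem_Y_of_mem x) hy
  | succ k ih =>
    intro x hx j y hy
    rw [Submodule.pow_succ] at hx
    refine Submodule.mul_induction_on hx (fun r hr s hs => ?_) (fun a b ha hb => ?_)
    · have h1 := mul_mem_Y_succ (mem_Y_of_mem s)
        (fun Q hQ => dual_mul_eq_zero_of_mem_radical hs hQ) hy
      have h2 := ih hr h1
      rw [MulMemClass.coe_mul, mul_assoc]
      exact Y_anti p (by omega) h2
    · rw [AddMemClass.coe_add, add_mul]
      exact add_mem ha hb

lemma blk_singleton (b : ℕ) (k : Fin n) : blk n {b} k = if b ≤ (k : ℕ) then 1 else 0 := by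
  unfold blk
  rw [filter_singleton]
  split_ifs <;> simp

lemma words_singleton_le {b : ℕ} {g : Fin n → ℕ} (hg : g ∈ words n {b}) (k : Fin n) : g k ≤ 1 := by
  obtain ⟨π, rfl⟩ := mem_words.1 hg
  rw [Function.comp_apply, blk_singleton]
  split_ifs <;> simp

lemma words_compl {b : ℕ} (hb : b ≤ n) {g : Fin n → ℕ} (hg : g ∈ words n {b}) :
    (fun k => 1 - g k) ∈ words n {n - b} := by
  obtain ⟨π, rfl⟩ := mem_words.1 hg
  refine mem_words.2 ⟨Fin.revPerm * π, ?_⟩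
  ext k
  simp only [Function.comp_apply, blk_singleton, Equiv.Perm.mul_apply, Fin.revPerm_apply,
    Fin.val_rev]
  split_ifs <;> omega

lemma card_zero_of_mem_words {b : ℕ} (hb : b ≤ n) {g : Fin n → ℕ} (hg : g ∈ words n {b}) :
    #{k | g k = 0} = b := by
  obtain ⟨π, rfl⟩ := mem_words.1 hg
  have h1 : #{k | (blk n {b} ∘ π) k = 0} = #{k | blk n {b} k = 0} := by
    refine card_bij (fun k _ => π k) (by simp) (fun _ _ _ _ h => π.injective h) fun k hk => ?_
    exact ⟨π⁻¹ k, by simpa using hk, by simp⟩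
  rw [h1]
  have h2 : ∀ k : Fin n, blk n {b} k = 0 ↔ (k : ℕ) < b := by
    intro k
    rw [blk_singleton]
    split_ifs <;> simp <;> omega
  simp only [h2]
  rw [Fin.card_filter_val_lt, min_eq_right hb]

lemma blk_mem_words (S : Finset ℕ) : blk n S ∈ words n S := mem_words.2 ⟨1, rfl⟩

lemma eq_of_jump_subset {g : Fin n → ℕ} {Q : Finset ℕ} (h : jump g ⊆ Q) {i j : Fin n}
    (hij : i ≤ j) (hQ : ∀ s ∈ Q, (i : ℕ) < s → (j : ℕ) < s) : g i = g j := by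
  rcases hij.lt_or_eq with hlt | rfl
  · have hlt' : (i : ℕ) < j := hlt
    refine rel_of_adjacent (r := fun i j => g i = g j) (fun _ _ _ => Eq.trans) (S := Q) ?_ i
      (j - i - 1) j (by omega) hQ
    intro i j hij hj
    by_contra hne
    exact hj (h ((mem_jump_iff hij).2 hne))
  · rfl

lemma eq_of_jump_subset_singleton {g : Fin n → ℕ} {a : ℕ} (h : jump g ⊆ {a}) {i j : Fin n}
    (hij : a ≤ (i : ℕ) ↔ a ≤ (j : ℕ)) : g i = g j := by
  rcases le_total i j with h' | h'
  · refine eq_of_jump_subset h h' fun s hs his => ?_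
    rw [mem_singleton] at hs
    omega
  · refine (eq_of_jump_subset h h' fun s hs his => ?_).symm
    rw [mem_singleton] at hs
    omega

lemma jump_compl {g : Fin n → ℕ} (hg : ∀ k, g k ≤ 1) : jump (fun k => 1 - g k) = jump g := by
  unfold jump
  refine filter_congr fun k _ => ?_
  refine exists_congr fun i => exists_congr fun j => ?_
  have := hg i
  have := hg j
  have : 1 - g i ≠ 1 - g j ↔ g i ≠ g j := by omega
  rw [this]

lemma jump_blk_subset (S : Finset ℕ) : jump (blk n S) ⊆ S := by
  intro k hk
  obtain ⟨-, i, j, hj, hi, hne⟩ := mem_filter.1 hk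
  by_contra hS
  refine hne (blk_eq_of_forall fun s hs => ?_)
  have : s ≠ k := fun e => hS (e ▸ hs)
  omega

lemma jump_subset_singleton_iff {a b : ℕ} (ha : a ∈ Ico 1 n) (hb : b ∈ Ico 1 n) {g : Fin n → ℕ}
    (hg : g ∈ words n {b}) :
    jump g ⊆ {a} ↔ g = blk n {a} ∨ g = fun k => 1 - blk n {a} k := by
  rw [mem_Ico] at ha hb
  constructor
  · intro h
    have hcard := card_zero_of_mem_words hb.2.le hg
    have hg1 := words_singleton_le hg
    have hz : ∀ k : Fin n, g k = if a ≤ (k : ℕ) then g ⟨n - 1, by omega⟩ else g ⟨0, by omega⟩ := by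
      intro k
      split_ifs with hk
      · exact eq_of_jump_subset_singleton h (by simp; omega)
      · exact eq_of_jump_subset_singleton h (by simp; omega)
    have h0 := hg1 ⟨0, by omega⟩
    have h1 := hg1 ⟨n - 1, by omega⟩
    generalize g ⟨0, by omega⟩ = u at hz h0
    generalize g ⟨n - 1, by omega⟩ = v at hz h1
    have huv : u ≠ v := by
      rintro rfl
      simp only [ite_self] at hz
      simp only [hz] at hcard
      by_cases hu : u = 0
      · simp [hu] at hcard
        omega
      · simp [hu] at hcard
        omega
    rcases (by omega : u = 0 ∧ v = 1 ∨ u = 1 ∧ v = 0) with ⟨rfl, rfl⟩ | ⟨rfl, rfl⟩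
    · left
      ext k
      rw [hz, blk_singleton]
    · right
      ext k
      rw [hz, blk_singleton]
      split_ifs <;> rfl
  · rintro (rfl | rfl)
    · exact jump_blk_subset _
    · rw [jump_compl (words_singleton_le (blk_mem_words _))]
      exact jump_blk_subset _

lemma blk_mem_words_iff {a b : ℕ} (ha : a ∈ Ico 1 n) (hb : b ∈ Ico 1 n) :
    blk n {a} ∈ words n {b} ↔ b = a := by
  rw [mem_Ico] at ha hb
  constructor
  · intro h
    rw [← card_zero_of_mem_words hb.2.le h, card_zero_of_mem_words ha.2.le (blk_mem_words _)]
  · rintro rfl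
    exact blk_mem_words _

lemma compl_blk_mem_words_iff {a b : ℕ} (ha : a ∈ Ico 1 n) (hb : b ∈ Ico 1 n) :
    (fun k => 1 - blk n {a} k) ∈ words n {b} ↔ b = n - a := by
  rw [mem_Ico] at ha hb
  constructor
  · intro h
    rw [← card_zero_of_mem_words hb.2.le h,
      card_zero_of_mem_words (Nat.sub_le n a) (words_compl ha.2.le (blk_mem_words _))]
  · rintro rfl
    exact words_compl ha.2.le (blk_mem_words _)

lemma card_le_one_of_jump_subset_singleton {a : ℕ} {S : Finset ℕ} (hS : S ⊆ Ico 1 n)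
    {g : Fin n → ℕ} (hg : g ∈ words n S) (h : jump g ⊆ {a}) : #S ≤ 1 := by
  obtain ⟨π, rfl⟩ := mem_words.1 hg
  refine card_le_one.2 fun s hs t ht => ?_
  by_contra hne
  wlog hst : s < t generalizing s t
  · exact this t ht s hs (Ne.symm hne) (by omega)
  have hs' := mem_Ico.1 (hS hs)
  have ht' := mem_Ico.1 (hS ht)
  have h1 : blk n S ⟨0, by omega⟩ < blk n S ⟨s, hs'.2⟩ := blk_lt_of_mem hs hs'.1 le_rfl
  have h2 : blk n S ⟨s, hs'.2⟩ < blk n S ⟨t, ht'.2⟩ := blk_lt_of_mem ht hst le_rfl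
  have key : ∀ i j : Fin n, (a ≤ (π⁻¹ i : ℕ) ↔ a ≤ (π⁻¹ j : ℕ)) → blk n S i = blk n S j := by
    intro i j hij
    simpa using eq_of_jump_subset_singleton h hij
  have k1 := key ⟨0, by omega⟩ ⟨s, hs'.2⟩
  have k2 := key ⟨s, hs'.2⟩ ⟨t, ht'.2⟩
  have k3 := key ⟨0, by omega⟩ ⟨t, ht'.2⟩
  omega

lemma dual_mul_B_singleton {p a : ℕ} (ha : a ∈ Ico 1 n) {x : GroupAlg n p} (hx : x ∈ Y n p 1) :
    dual n p {a} (x * B n p {a}) = dual n p {a} x + dual n p {n - a} x := by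
  have ha' := mem_Ico.1 ha
  have hsub : ({a} : Finset ℕ) ⊆ Ico 1 n := singleton_subset_iff.2 ha
  have hsub' : ({n - a} : Finset ℕ) ⊆ Ico 1 n :=
    singleton_subset_iff.2 (mem_Ico.2 ⟨by omega, by omega⟩)
  refine Y_induction (C := fun x => dual n p {a} (x * B n p {a}) =
    dual n p {a} x + dual n p {n - a} x) (fun S hS hj => ?_) (by simp) (fun x y hx hy => ?_)
    (fun c x hx => ?_) hx
  · rw [dual_B_mul_B p S hsub, dual_B p hsub hS, dual_B p hsub' hS]
    by_cases h1 : #S = 1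
    · obtain ⟨b, rfl⟩ := card_eq_one.1 h1
      have hb : b ∈ Ico 1 n := singleton_subset_iff.1 hS
      have hne : blk n {a} ≠ fun k => 1 - blk n {a} k := by
        intro e
        have := congrFun e ⟨0, by omega⟩
        omega
      have : ∀ g ∈ words n {b}, (if jump g ⊆ {a} then (1 : ZMod p) else 0) =
          (if g = blk n {a} then 1 else 0) + (if g = fun k => 1 - blk n {a} k then 1 else 0) := by
        intro g hg
        simp only [jump_subset_singleton_iff ha hb hg]
        by_cases e1 : g = blk n {a}
        · subst e1
          simp [hne]
        · simp [e1]
      rw [sum_congr rfl this, sum_add_distrib, sum_ite_eq', sum_ite_eq']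
      simp only [blk_mem_words_iff ha hb, compl_blk_mem_words_iff ha hb, singleton_inj]
    · rw [if_neg (fun e => h1 (by simp [e])), if_neg (fun e => h1 (by simp [e])), add_zero]
      refine sum_eq_zero fun g hg => if_neg fun h => ?_
      have := card_le_one_of_jump_subset_singleton hS hg h
      omega
  · rw [add_mul, map_add, map_add, map_add, hx, hy]
    abel
  · rw [smul_mul_assoc, map_smul, map_smul, map_smul, hx, smul_add]

lemma sub_sum_dual_mem_Y {p : ℕ} {x : GroupAlg n p} (hx : x ∈ Y n p 1) :
    x - ∑ a ∈ Ico 1 n, dual n p {a} x • B n p {a} ∈ Y n p 2 := by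
  refine Y_induction (C := fun x => x - ∑ a ∈ Ico 1 n, dual n p {a} x • B n p {a} ∈ Y n p 2)
    (fun S hS hj => ?_) (by simp) (fun x y hx hy => ?_) (fun c x hx => ?_) hx
  · have h1 : ∀ a ∈ Ico 1 n, dual n p {a} (B n p S) • B n p {a} =
        if S = {a} then B n p {a} else 0 := by
      intro a ha
      rw [dual_B p (singleton_subset_iff.2 ha) hS, ite_smul, one_smul, zero_smul]
    rw [sum_congr rfl h1]
    by_cases h1 : #S = 1
    · obtain ⟨b, rfl⟩ := card_eq_one.1 h1
      have hb : b ∈ Ico 1 n := singleton_subset_iff.1 hS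
      simp only [singleton_inj]
      rw [sum_ite_eq, if_pos hb, sub_self]
      exact zero_mem _
    · rw [sum_eq_zero fun a _ => if_neg fun e => h1 (by simp [e]), sub_zero]
      exact B_mem_Y hS (by omega)
  · simp only [map_add, add_smul, sum_add_distrib]
    rw [add_sub_add_comm]
    exact add_mem hx hy
  · simp only [map_smul, smul_assoc]
    rw [← smul_sum, ← smul_sub]
    exact Submodule.smul_mem _ _ hx

lemma eq_zero_of_dual_full {p : ℕ} {z : GroupAlg n p} (hz : z ∈ Y n p (n - 1))
    (h : dual n p (Ico 1 n) z = 0) : z = 0 := by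
  have key : z = dual n p (Ico 1 n) z • B n p (Ico 1 n) := by
    refine Y_induction (C := fun z => z = dual n p (Ico 1 n) z • B n p (Ico 1 n))
      (fun S hS hj => ?_) (by simp) (fun x y hx hy => ?_) (fun c x hx => ?_) hz
    · have : S = Ico 1 n := eq_of_subset_of_card_le hS (by rwa [Nat.card_Ico])
      rw [this, dual_B p subset_rfl subset_rfl, if_pos rfl, one_smul]
    · rw [map_add, add_smul, ← hx, ← hy]
    · rw [map_smul, smul_assoc, ← hx]
  rw [key, h, zero_smul]

/-- `g` is strictly increasing at every adjacent pair of positions not cut at `a`. -/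
def StrictOff (a : ℕ) (g : Fin n → ℕ) : Prop :=
  ∀ i j : Fin n, (j : ℕ) = i + 1 → (j : ℕ) ≠ a → g i < g j

lemma strictOff_iff {a : ℕ} (ha : a ∈ Ico 1 n) (g : Fin n → ℕ) :
    StrictOff a g ↔ Weak g {a} ∧ {a} ∪ jump g = Ico 1 n := by
  constructor
  · refine fun h => ⟨fun i j hij hj => (h i j hij (by simpa using hj)).le,
      (union_subset (singleton_subset_iff.2 ha) (jump_subset g)).antisymm fun k hk => ?_⟩
    rw [mem_Ico] at hk
    by_cases hka : k = a
    · simp [hka]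
    · refine mem_union_right _ ?_
      have h1 : ((⟨k, hk.2⟩ : Fin n) : ℕ) = (⟨k - 1, by omega⟩ : Fin n) + 1 := by simp; omega
      exact (mem_jump_iff h1).2 (h _ _ h1 hka).ne
  · rintro ⟨hw, hu⟩ i j hij hj
    have hjm : (j : ℕ) ∈ {a} ∪ jump g := by
      rw [hu, mem_Ico]
      omega
    have hj' : (j : ℕ) ∈ jump g := by simpa [hj] using hjm
    exact lt_of_le_of_ne (hw i j hij (by simpa using hj)) ((mem_jump_iff hij).1 hj')

lemma dual_full_B_mul_B (p : ℕ) (S : Finset ℕ) {a : ℕ} (ha : a ∈ Ico 1 n) :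
    dual n p (Ico 1 n) (B n p S * B n p {a}) =
      ∑ g ∈ words n S, if StrictOff a g then 1 else 0 := by
  rw [B_mul_B, map_sum]
  refine sum_congr rfl fun g _ => ?_
  have hs := union_subset (singleton_subset_iff.2 ha) (jump_subset g)
  simp only [strictOff_iff ha]
  by_cases hw : Weak g {a}
  · simp only [hw, if_true, true_and]
    rw [dual_B p subset_rfl hs]
  · simp [hw]

lemma addRight_val [NeZero n] {a : ℕ} (ha : a < n) (k : Fin n) :
    ((Equiv.addRight (Fin.ofNat n a) k : Fin n) : ℕ) =
      if (k : ℕ) + a < n then k + a else k + a - n := by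
  rw [Equiv.coe_addRight, Fin.val_add, Fin.val_ofNat, Nat.mod_eq_of_lt ha]
  split_ifs with h
  · exact Nat.mod_eq_of_lt h
  · rw [Nat.mod_eq_sub_mod (by omega), Nat.mod_eq_of_lt (by omega)]

lemma StrictOff.rotate [NeZero n] {a : ℕ} (ha : a ∈ Ico 1 n) {g : Fin n → ℕ}
    (h : StrictOff a g) : StrictOff (n - a) (g ∘ Equiv.addRight (Fin.ofNat n a)) := by
  intro i j hij hj
  rw [mem_Ico] at ha
  have hi' := addRight_val ha.2 i
  have hj' := addRight_val ha.2 j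
  refine h _ _ ?_ ?_
  · rw [hi', hj']
    split_ifs <;> omega
  · rw [hj']
    split_ifs <;> omega

lemma rotate_rotate [NeZero n] {a : ℕ} (ha : a ∈ Ico 1 n) (g : Fin n → ℕ) :
    (g ∘ Equiv.addRight (Fin.ofNat n a)) ∘ Equiv.addRight (Fin.ofNat n (n - a)) = g := by
  rw [mem_Ico] at ha
  ext k
  refine congrArg g (Fin.ext ?_)
  rw [addRight_val ha.2, addRight_val (by omega)]
  split_ifs <;> omega

lemma exists_notMem_of_blk_eq {S : Finset ℕ} {i j : Fin n} (hij : i ≠ j)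
    (h : blk n S i = blk n S j) : ∃ s : Fin n, (s : ℕ) ∈ Ico 1 n \ S ∧ blk n S s = blk n S i := by
  wlog hlt : i < j generalizing i j
  · obtain ⟨s, hs, hs'⟩ := this hij.symm h.symm (lt_of_le_of_ne (not_lt.1 hlt) hij.symm)
    exact ⟨s, hs, hs'.trans h.symm⟩
  · have hlt' : (i : ℕ) < j := hlt
    refine ⟨j, mem_sdiff.2 ⟨mem_Ico.2 ⟨by omega, j.2⟩, fun hS => ?_⟩, h.symm⟩
    exact (blk_lt_of_mem hS hlt' le_rfl).ne h

lemma not_fixed_of_strictOff [NeZero n] (hn : 3 ≤ n) {a : ℕ} (ha : a ∈ Ico 1 n)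
    {S : Finset ℕ} (hS : S ⊆ Ico 1 n) (hcard : n - 2 ≤ #S) {g : Fin n → ℕ} (hg : g ∈ words n S)
    (h : StrictOff a g) (hna : n - a = a) : g ∘ Equiv.addRight (Fin.ofNat n a) ≠ g := by
  intro e
  rw [mem_Ico] at ha
  obtain ⟨π, rfl⟩ := mem_words.1 hg
  have key : ∀ k : Fin n, ∃ s : Fin n, (s : ℕ) ∈ Ico 1 n \ S ∧ blk n S s = blk n S (π k) := by
    intro k
    refine exists_notMem_of_blk_eq (fun h => ?_) (congrFun e k).symm
    have h1 := congrArg Fin.val (π.injective h)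
    rw [addRight_val ha.2] at h1
    split_ifs at h1 <;> omega
  obtain ⟨s, hs, hs'⟩ := key ⟨0, by omega⟩
  obtain ⟨t, ht, ht'⟩ := key ⟨1, by omega⟩
  have h01 := h ⟨0, by omega⟩ ⟨1, by omega⟩ rfl (by simp; omega)
  have hst : (s : ℕ) ≠ t := by
    intro hst
    rw [Fin.ext hst] at hs'
    exact h01.ne (hs'.symm.trans ht')
  have h2 : 1 < #(Ico 1 n \ S) := one_lt_card.2 ⟨s, hs, t, ht, hst⟩
  rw [card_sdiff_of_subset hS, Nat.card_Ico] at h2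
  omega

lemma dual_full_mul_sum_eq_zero {p : ℕ} (hn : 3 ≤ n) {y : GroupAlg n p} (hy : y ∈ Y n p (n - 2))
    {w : ℕ → ZMod p} (hw : ∀ a ∈ Ico 1 n, w a + w (n - a) = 0) :
    dual n p (Ico 1 n) (y * ∑ a ∈ Ico 1 n, w a • B n p {a}) = 0 := by
  have : NeZero n := ⟨by omega⟩
  refine Y_induction (C := fun y => dual n p (Ico 1 n) (y * ∑ a ∈ Ico 1 n, w a • B n p {a}) = 0)
    (fun S hS hj => ?_) (by simp) (fun x y hx hy => by rw [add_mul, map_add, hx, hy, add_zero])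
    (fun c x hx => by rw [smul_mul_assoc, map_smul, hx, smul_zero]) hy
  have h1 : dual n p (Ico 1 n) (B n p S * ∑ a ∈ Ico 1 n, w a • B n p {a}) =
      ∑ x ∈ Ico 1 n ×ˢ words n S, if StrictOff x.1 x.2 then w x.1 else 0 := by
    rw [mul_sum, map_sum, sum_product]
    refine sum_congr rfl fun a ha => ?_
    rw [mul_smul_comm, map_smul, dual_full_B_mul_B p S ha, smul_sum]
    refine sum_congr rfl fun g _ => ?_
    split_ifs <;> simp
  rw [h1]
  have hmem : ∀ a ∈ Ico 1 n, n - a ∈ Ico 1 n := fun a ha => by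
    rw [mem_Ico] at ha ⊢
    omega
  have hsub : ∀ a ∈ Ico 1 n, n - (n - a) = a := fun a ha => by
    rw [mem_Ico] at ha
    omega
  refine sum_involution
    (fun x _ => (n - x.1, x.2 ∘ Equiv.addRight (Fin.ofNat n x.1))) ?_ ?_ ?_ ?_
  · rintro ⟨a, g⟩ hx
    obtain ⟨ha, hg⟩ := mem_product.1 hx
    have hiff : StrictOff (n - a) (g ∘ Equiv.addRight (Fin.ofNat n a)) ↔ StrictOff a g := by
      refine ⟨fun h => ?_, fun h => h.rotate ha⟩
      have := h.rotate (hmem a ha)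
      rwa [rotate_rotate ha, hsub a ha] at this
    simp only [hiff]
    split_ifs
    · exact hw a ha
    · exact add_zero 0
  · rintro ⟨a, g⟩ hx hne e
    obtain ⟨ha, hg⟩ := mem_product.1 hx
    have hP : StrictOff a g := by
      by_contra hP
      exact hne (if_neg hP)
    exact not_fixed_of_strictOff hn ha hS hj hg hP (congrArg Prod.fst e) (congrArg Prod.snd e)
  · rintro ⟨a, g⟩ hx
    obtain ⟨ha, hg⟩ := mem_product.1 hx
    exact mem_product.2 ⟨hmem a ha, words_comp hg _⟩
  · rintro ⟨a, g⟩ hx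
    obtain ⟨ha, hg⟩ := mem_product.1 hx
    exact Prod.ext (hsub a ha) (rotate_rotate ha g)

lemma radical_pow_eq_bot {p : ℕ} [Fact p.Prime] (hn : 3 ≤ n) :
    descentRadical n p ^ (n - 1) = ⊥ := by
  rw [show n - 1 = (n - 2) + 1 by omega, Submodule.pow_succ, eq_bot_iff]
  intro z hz
  refine Submodule.mul_induction_on hz (fun y hy x hx => ?_) fun a b ha hb => add_mem ha hb
  have hy2 : (y : GroupAlg n p) ∈ Y n p (n - 2) := by
    simpa using mul_mem_Y_of_mem_radical_pow _ hy (one_mem_Y p)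
  have hd : ∀ Q ⊆ Ico 1 n, dual n p Q (x * B n p Q) = 0 :=
    fun Q hQ => dual_mul_eq_zero_of_mem_radical hx hQ
  have hx1 : (x : GroupAlg n p) ∈ Y n p 1 := by
    simpa using mul_mem_Y_succ (mem_Y_of_mem x) hd (one_mem_Y p)
  have hyx : (y : GroupAlg n p) * x ∈ Y n p (n - 1) := by
    have := mul_mem_Y_of_mem_radical_pow _ hy hx1
    rwa [show 1 + (n - 2) = n - 1 by omega] at this
  have hzero : (y : GroupAlg n p) * (x - ∑ a ∈ Ico 1 n, dual n p {a} (x : GroupAlg n p) •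
      B n p {a}) = 0 :=
    Y_eq_zero (by omega) (by omega) (mul_mem_Y_of_mem_radical_pow _ hy (sub_sum_dual_mem_Y hx1))
  rw [mul_sub, sub_eq_zero] at hzero
  rw [Ideal.mem_bot]
  refine Subtype.ext ?_
  rw [MulMemClass.coe_mul]
  refine eq_zero_of_dual_full hyx ?_
  rw [hzero]
  refine dual_full_mul_sum_eq_zero hn hy2 fun a ha => ?_
  rw [← dual_mul_B_singleton ha hx1]
  exact hd _ (singleton_subset_iff.2 ha)

/-- The set of all cuts except those strictly inside the block `[i, i + m)`. -/
def cutsOff (n i m : ℕ) : Finset ℕ := (Ico 1 n).filter fun k => ¬ (i < k ∧ k < i + m)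

lemma mem_cutsOff {i m k : ℕ} :
    k ∈ cutsOff n i m ↔ (1 ≤ k ∧ k < n) ∧ ¬ (i < k ∧ k < i + m) := by
  rw [cutsOff, mem_filter, mem_Ico]

/-- The word with a single `0`, at position `c`, and all other letters `1`. -/
def zeroAt (c k : Fin n) : ℕ := if k = c then 0 else 1

lemma words_one (hn : 2 ≤ n) : words n {1} = univ.image (zeroAt (n := n)) := by
  ext g
  rw [mem_words, mem_image]
  have h0 : ∀ k : Fin n, blk n {1} k = if k = ⟨0, by omega⟩ then 0 else 1 := by
    intro k
    rw [blk_singleton]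
    simp only [Fin.ext_iff]
    split_ifs <;> omega
  constructor
  · rintro ⟨π, rfl⟩
    refine ⟨π⁻¹ ⟨0, by omega⟩, mem_univ _, ?_⟩
    ext k
    simp only [Function.comp_apply, h0, zeroAt, Equiv.Perm.eq_inv_iff_eq]
  · rintro ⟨c, -, rfl⟩
    refine ⟨Equiv.swap c ⟨0, by omega⟩, ?_⟩
    ext k
    simp only [Function.comp_apply, h0, zeroAt, Equiv.swap_apply_eq_iff, Equiv.swap_apply_right]

lemma zeroAt_injective : Function.Injective (zeroAt (n := n)) := by
  intro c d h
  by_contra hne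
  have := congrFun h c
  simp [zeroAt, hne] at this

lemma zeroAt_le_one (c k : Fin n) : zeroAt c k ≤ 1 := by
  unfold zeroAt
  split_ifs <;> omega

lemma mem_jump_zeroAt {c : Fin n} {k : ℕ} :
    k ∈ jump (zeroAt c) ↔ (1 ≤ k ∧ k < n) ∧ (k = c ∨ k = c + 1) := by
  rw [← mem_Ico]
  refine ⟨fun h => ⟨jump_subset _ h, ?_⟩, fun ⟨h, hc⟩ => ?_⟩
  · obtain ⟨-, i, j, hj, hi, hne⟩ := mem_filter.1 h
    simp only [zeroAt, Fin.ext_iff] at hne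
    split_ifs at hne <;> omega
  · rw [mem_Ico] at h
    have h1 : ((⟨k, h.2⟩ : Fin n) : ℕ) = (⟨k - 1, by omega⟩ : Fin n) + 1 := by simp; omega
    refine (mem_jump_iff h1).2 ?_
    simp only [zeroAt, Fin.ext_iff]
    split_ifs <;> omega

lemma weak_zeroAt_iff {c : Fin n} {i m : ℕ} :
    Weak (zeroAt c) (cutsOff n i m) ↔ ¬ (i < c ∧ (c : ℕ) < i + m) := by
  constructor
  · intro h hc
    have := h ⟨c - 1, by omega⟩ c (by simp; omega) fun hm => (mem_cutsOff.1 hm).2 hc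
    simp only [zeroAt, Fin.ext_iff] at this
    split_ifs at this <;> omega
  · intro h k l hkl hl
    rw [mem_cutsOff] at hl
    simp only [zeroAt, Fin.ext_iff]
    split_ifs <;> omega

lemma weak_compl_zeroAt_iff {c : Fin n} {i m : ℕ} (him : i + m ≤ n) :
    Weak (fun k => 1 - zeroAt c k) (cutsOff n i m) ↔ ¬ (i ≤ c ∧ (c : ℕ) + 1 < i + m) := by
  constructor
  · intro h hc
    have := h c ⟨c + 1, by omega⟩ rfl fun hm => (mem_cutsOff.1 hm).2 (by simp; omega)
    simp only [zeroAt, Fin.ext_iff] at this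
    split_ifs at this <;> omega
  · intro h k l hkl hl
    rw [mem_cutsOff] at hl
    simp only [zeroAt, Fin.ext_iff]
    split_ifs <;> omega

/-- The radical element `B{1} - B{n-1}`. -/
def radElt (n p : ℕ) : GroupAlg n p := B n p {1} - B n p {n - 1}

lemma sum_words_singleton {M : Type*} [AddCommMonoid M] {b : ℕ} (hb : b ≤ n)
    (f : (Fin n → ℕ) → M) :
    ∑ g ∈ words n {n - b}, f g = ∑ g ∈ words n {b}, f fun k => 1 - g k := by
  symm
  have hinv : ∀ {c : ℕ} {g : Fin n → ℕ}, g ∈ words n {c} → (fun k => 1 - (1 - g k)) = g :=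
    fun hg => funext fun k => Nat.sub_sub_self (words_singleton_le hg k)
  refine sum_bij' (fun g _ k => 1 - g k) (fun g _ k => 1 - g k) (fun g hg => words_compl hb hg)
    (fun g hg => ?_) (fun g hg => hinv hg) (fun g hg => hinv hg) fun g hg => rfl
  have := words_compl (Nat.sub_le n b) hg
  rwa [Nat.sub_sub_self hb] at this

lemma dual_radElt_mul_B (p : ℕ) (hn : 1 ≤ n) {Q : Finset ℕ} (hQ : Q ⊆ Ico 1 n) :
    dual n p Q (radElt n p * B n p Q) = 0 := by
  rw [radElt, sub_mul, map_sub, dual_B_mul_B p _ hQ, dual_B_mul_B p _ hQ, sum_words_singleton hn,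
    sub_eq_zero]
  exact sum_congr rfl fun g hg => by rw [jump_compl (words_singleton_le hg)]

lemma radElt_mem_Y (p : ℕ) (hn : 2 ≤ n) : radElt n p ∈ Y n p 0 :=
  sub_mem (B_mem_Y (singleton_subset_iff.2 (mem_Ico.2 ⟨le_rfl, hn⟩)) (Nat.zero_le _))
    (B_mem_Y (singleton_subset_iff.2 (mem_Ico.2 ⟨by omega, by omega⟩)) (Nat.zero_le _))

/-- `radElt` as an element of the descent algebra. -/
def radEltS (n p : ℕ) (hn : 2 ≤ n) : descentAlgebra n p :=
  ⟨radElt n p, mem_descentAlgebra_iff.2 (radElt_mem_Y p hn)⟩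

lemma radEltS_mem_radical (p : ℕ) (hn : 2 ≤ n) : radEltS n p hn ∈ descentRadical n p := by
  refine Ideal.mem_jacobson_iff.2 fun y => ?_
  have hY : ∀ k, ((y * radEltS n p hn : descentAlgebra n p) : GroupAlg n p) ^ k ∈ Y n p k := by
    intro k
    induction k with
    | zero => simpa using one_mem_Y p
    | succ k ih =>
      rw [pow_succ', MulMemClass.coe_mul, mul_assoc]
      exact mul_mem_Y (mem_Y_of_mem y) (mul_mem_Y_succ (radElt_mem_Y p hn)
        (fun Q hQ => dual_radElt_mul_B p (by omega) hQ) ih)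
  have hnil : IsNilpotent (y * radEltS n p hn) :=
    ⟨n, Subtype.ext (by
      rw [SubmonoidClass.coe_pow]
      exact Y_eq_zero le_rfl (by omega) (hY n))⟩
  obtain ⟨u, hu⟩ := hnil.isUnit_one_add
  refine ⟨↑u⁻¹, ?_⟩
  rw [Ideal.mem_bot, sub_eq_zero, mul_assoc, add_comm, ← mul_one_add, ← hu, Units.inv_mul]

lemma radElt_mul_cutsOff (p : ℕ) {i m : ℕ} (hm : 2 ≤ m) (him : i + m ≤ n) :
    radElt n p * B n p (cutsOff n i m) =
      B n p (cutsOff n (i + 1) (m - 1)) - B n p (cutsOff n i (m - 1)) := by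
  rw [radElt, sub_mul, B_mul_B, B_mul_B, sum_words_singleton (by omega), words_one (by omega),
    sum_image zeroAt_injective.injOn, sum_image zeroAt_injective.injOn, ← sum_sub_distrib]
  have key : ∀ c : Fin n, ((if Weak (zeroAt c) (cutsOff n i m)
      then B n p (cutsOff n i m ∪ jump (zeroAt c)) else 0) -
      if Weak (fun k => 1 - zeroAt c k) (cutsOff n i m)
      then B n p (cutsOff n i m ∪ jump fun k => 1 - zeroAt c k) else 0) =
      (if c = ⟨i, by omega⟩ then B n p (cutsOff n (i + 1) (m - 1)) else 0) -
      if c = ⟨i + m - 1, by omega⟩ then B n p (cutsOff n i (m - 1)) else 0 := by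
    intro c
    rw [jump_compl (zeroAt_le_one c)]
    simp only [weak_zeroAt_iff, weak_compl_zeroAt_iff him, Fin.ext_iff]
    by_cases h1 : (c : ℕ) = i
    · rw [if_pos (by omega), if_neg (by omega), if_pos h1, if_neg (by omega)]
      congr 2
      ext k
      rw [mem_union, mem_cutsOff, mem_cutsOff, mem_jump_zeroAt]
      omega
    · by_cases h2 : (c : ℕ) = i + m - 1
      · rw [if_neg (by omega), if_pos (by omega), if_neg h1, if_pos h2]
        congr 2
        ext k
        rw [mem_union, mem_cutsOff, mem_cutsOff, mem_jump_zeroAt]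
        omega
      · rw [if_neg h1, if_neg h2]
        by_cases h3 : i < c ∧ (c : ℕ) < i + m
        · rw [if_neg (by omega), if_neg (by omega)]
        · rw [if_pos (by omega), if_pos (by omega), sub_self, sub_self]
  rw [sum_congr rfl fun c _ => key c, sum_sub_distrib, sum_ite_eq', sum_ite_eq', if_pos (mem_univ _),
    if_pos (mem_univ _)]

lemma radElt_pow_sub_mem_span (p : ℕ) {k : ℕ} (hk : k + 2 ≤ n) :
    radElt n p ^ k - (-1 : ZMod p) ^ k • B n p (cutsOff n 0 (n - k)) ∈
      Submodule.span (ZMod p) {x | ∃ i, 1 ≤ i ∧ i ≤ k ∧ x = B n p (cutsOff n i (n - k))} := by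
  induction k with
  | zero =>
    have : cutsOff n 0 (n - 0) = ∅ := by
      ext k
      rw [mem_cutsOff]
      simp
      omega
    rw [this, B_empty]
    simp
  | succ k ih =>
    have step := fun i (hi : i ≤ k) =>
      radElt_mul_cutsOff (n := n) p (i := i) (m := n - k) (by omega) (by omega)
    rw [show n - k - 1 = n - (k + 1) by omega] at step
    have hmul : ∀ x ∈ Submodule.span (ZMod p)
        {x | ∃ i, 1 ≤ i ∧ i ≤ k ∧ x = B n p (cutsOff n i (n - k))},
        radElt n p * x ∈ Submodule.span (ZMod p)
          {x | ∃ i, 1 ≤ i ∧ i ≤ k + 1 ∧ x = B n p (cutsOff n i (n - (k + 1)))} := by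
      intro x hx
      induction hx using Submodule.span_induction with
      | mem x h =>
        obtain ⟨i, hi1, hik, rfl⟩ := h
        rw [step i hik]
        exact sub_mem (Submodule.subset_span ⟨i + 1, by omega, by omega, rfl⟩)
          (Submodule.subset_span ⟨i, hi1, by omega, rfl⟩)
      | zero => rw [mul_zero]; exact zero_mem _
      | add x y _ _ hx hy => rw [mul_add]; exact add_mem hx hy
      | smul a x _ hx => rw [mul_smul_comm]; exact Submodule.smul_mem _ _ hx
    have h1 := hmul _ (ih (by omega))
    rw [mul_sub, mul_smul_comm, step 0 (Nat.zero_le _), ← pow_succ', smul_sub] at h1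
    have h2 : B n p (cutsOff n (0 + 1) (n - (k + 1))) ∈ Submodule.span (ZMod p)
        {x | ∃ i, 1 ≤ i ∧ i ≤ k + 1 ∧ x = B n p (cutsOff n i (n - (k + 1)))} :=
      Submodule.subset_span ⟨1, le_rfl, by omega, rfl⟩
    have h3 := add_mem h1 (Submodule.smul_mem _ ((-1 : ZMod p) ^ k) h2)
    convert h3 using 1
    rw [pow_succ (-1 : ZMod p), mul_neg_one, neg_smul]
    abel

lemma radElt_pow_ne_zero (p : ℕ) [Fact p.Prime] (hn : 2 ≤ n) : radElt n p ^ (n - 2) ≠ 0 := by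
  intro h
  have h1 := radElt_pow_sub_mem_span (n := n) p (k := n - 2) (by omega)
  rw [h, zero_sub, show n - (n - 2) = 2 by omega] at h1
  have hT : Ico 2 n ⊆ Ico 1 n := Ico_subset_Ico_left (by omega)
  have hker : ∀ x ∈ Submodule.span (ZMod p)
      {x | ∃ i, 1 ≤ i ∧ i ≤ n - 2 ∧ x = B n p (cutsOff n i 2)},
      coeffAt p (descPerm n (Ico 2 n)) x = 0 := by
    intro x hx
    induction hx using Submodule.span_induction with
    | mem x h =>
      obtain ⟨i, hi1, hik, rfl⟩ := h
      rw [coeffAt_B, asc_descPerm_iff hT, if_neg]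
      intro hsub
      have := mem_cutsOff.1 (hsub (mem_Ico.2 (⟨by omega, by omega⟩ : 2 ≤ i + 1 ∧ i + 1 < n)))
      omega
    | zero => exact map_zero _
    | add x y _ _ hx hy => rw [map_add, hx, hy, add_zero]
    | smul a x _ hx => rw [map_smul, hx, smul_zero]
  have h2 := hker _ h1
  rw [map_neg, map_smul, coeffAt_B, asc_descPerm_iff hT, if_pos, neg_eq_zero, smul_eq_mul,
    mul_one] at h2
  · exact pow_ne_zero _ (neg_ne_zero.2 one_ne_zero) h2
  · intro k hk
    rw [mem_Ico] at hk
    rw [mem_cutsOff]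
    omega

lemma radical_pow_ne_bot (p : ℕ) [Fact p.Prime] (hn : 2 ≤ n) :
    descentRadical n p ^ (n - 2) ≠ ⊥ := by
  intro h
  have h1 := Ideal.pow_mem_pow (radEltS_mem_radical p hn) (n - 2)
  rw [h, Ideal.mem_bot] at h1
  refine radElt_pow_ne_zero p hn ?_
  exact (SubmonoidClass.coe_pow (radEltS n p hn) _).symm.trans (congrArg Subtype.val h1)

end DescentAlgebra

/-- For `n ≥ 3` and any prime `p`, the nilpotency index of `R(n,p)` is
exactly `n - 1`: `R(n,p)^{n-1} = 0` but `R(n,p)^{n-2} ≠ 0`. -/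
theorem stmt16 (n p : ℕ) (hn : 3 ≤ n) (hp : p.Prime) :
    descentRadical n p ^ (n - 1) = ⊥ ∧ descentRadical n p ^ (n - 2) ≠ ⊥ := by
  have := Fact.mk hp
  exact ⟨DescentAlgebra.radical_pow_eq_bot hn, DescentAlgebra.radical_pow_ne_bot p (by omega)⟩

end
end
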